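/- arXiv:1503.08793 — 4 statements merged into one kernel-verified Lean document; each statement's English description precedes it below -/
import Mathlib

section
/- If Condition (1) holds, i.e. log P(x) / (a x^b) → 1 as x^b → ∞, then Condition (2) holds, i.e. log f(λ) / (d λ^{b/(1−b)}) → 1 as λ^{b/(1−b)} → ∞. -/
open Real Filter MeasureTheory Set

/-- Bernoulli's inequality for all real exponents, weighted by a constant `a` for which
`t ↦ a * t ^ b` is concave. -/
theorem mul_rpow_le_tangent {a b t : ℝ} (hab : a * b * (b - 1) < 0) (ht : 0 < t) :
    a * t ^ b ≤ a * (1 + b * (t - 1)) := by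
  have ht' : (-1 : ℝ) ≤ t - 1 := by linarith
  have hpow : (1 + (t - 1)) ^ b = t ^ b := by congr 1; ring
  rcases lt_trichotomy b 0 with hb | rfl | hb
  · have ha : a ≤ 0 := by
      by_contra! h
      nlinarith [mul_pos h (mul_pos_of_neg_of_neg hb (by linarith : b - 1 < 0))]
    refine mul_le_mul_of_nonpos_left ?_ ha
    have h1 := Real.add_one_le_exp (Real.log t * b)
    have h2 := Real.log_le_sub_one_of_pos ht
    rw [Real.rpow_def_of_pos ht]
    nlinarith
  · simp at hab
  · rcases le_total b 1 with hb1 | hb1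
    · have ha : 0 ≤ a := by
        by_contra! h
        nlinarith [mul_nonneg (mul_nonneg (neg_pos.2 h).le hb.le) (sub_nonneg.2 hb1)]
      refine mul_le_mul_of_nonneg_left ?_ ha
      rw [← hpow]
      exact rpow_one_add_le_one_add_mul_self ht' hb.le hb1
    · have ha : a ≤ 0 := by
        by_contra! h
        nlinarith [mul_nonneg (mul_nonneg h.le hb.le) (sub_nonneg.2 hb1)]
      refine mul_le_mul_of_nonpos_left ?_ ha
      rw [← hpow]
      exact one_add_mul_self_le_rpow_one_add ht' hb1

theorem neg_mul_div_pos {a b c : ℝ} (habc : a * b * c < 0) : 0 < -a * b / c := by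
  have hc : c ≠ 0 := by rintro rfl; simp at habc
  have h : -a * b / c = -(a * b * c) / c ^ 2 := by field_simp
  rw [h]
  exact div_pos (neg_pos.2 habc) (by positivity)

/-- The value of `x ↦ a * x ^ b + c * x` at its critical point. -/
theorem mul_rpow_add_mul_critical {a b c : ℝ} (hb1 : b ≠ 1) (habc : a * b * c < 0) :
    a * ((-a * b / c) ^ (1 / (1 - b))) ^ b + c * (-a * b / c) ^ (1 / (1 - b)) =
      a * (1 - b) * (-a * b / c) ^ (b / (1 - b)) := by
  have hc : c ≠ 0 := by rintro rfl; simp at habc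
  have hy := neg_mul_div_pos habc
  have hb : 1 - b ≠ 0 := sub_ne_zero.2 hb1.symm
  rw [← Real.rpow_mul hy.le, show 1 / (1 - b) * b = b / (1 - b) by ring,
    show 1 / (1 - b) = 1 + b / (1 - b) by field_simp; ring, Real.rpow_add hy, Real.rpow_one]
  field_simp
  ring

/-- The function `x ↦ a * x ^ b + c * x` is bounded by its value at the critical point. -/
theorem mul_rpow_add_mul_le {a b c x : ℝ} (hb1 : b ≠ 1) (hab : a * b * (b - 1) < 0)
    (habc : a * b * c < 0) (hx : 0 < x) :
    a * x ^ b + c * x ≤ a * (1 - b) * (-a * b / c) ^ (b / (1 - b)) := by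
  have hc : c ≠ 0 := by rintro rfl; simp at habc
  have hy := neg_mul_div_pos habc
  have hb : 1 - b ≠ 0 := sub_ne_zero.2 hb1.symm
  rw [← mul_rpow_add_mul_critical hb1 habc]
  set y := -a * b / c with hydef
  set m := y ^ (1 / (1 - b)) with hm
  have hm0 : 0 < m := Real.rpow_pos_of_pos hy _
  have hmb : m = m ^ b * y := by
    rw [hm, ← Real.rpow_mul hy.le]
    nth_rewrite 3 [← Real.rpow_one y]
    rw [← Real.rpow_add hy]
    congr 1
    field_simp
    ring
  have h := mul_le_mul_of_nonneg_left (mul_rpow_le_tangent hab (div_pos hx hm0))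
    (Real.rpow_pos_of_pos hm0 b).le
  rw [Real.div_rpow hx.le hm0.le] at h
  have h1 : m ^ b * (a * (x ^ b / m ^ b)) = a * x ^ b := by
    field_simp
  have h2 : m ^ b * (a * (1 + b * (x / m - 1))) = a * m ^ b + c * m - c * x := by
    have : a * b * m ^ b = - c * m := by
      rw [hydef] at hmb
      field_simp at hmb
      linarith
    have h3 : m ^ b * (a * (1 + b * (x / m - 1))) = a * m ^ b + (a * b * m ^ b) * (x / m - 1) := by
      ring
    rw [h3, this]
    field_simp
    ring
  linarith

theorem tendsto_rpow_inv_atTop_atTop {b : ℝ} (hb : 0 < b) :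
    Tendsto (fun y : ℝ => y ^ b⁻¹) atTop atTop :=
  tendsto_rpow_atTop (inv_pos.2 hb)

theorem tendsto_rpow_inv_atTop_nhdsGT_zero {b : ℝ} (hb : b < 0) :
    Tendsto (fun y : ℝ => y ^ b⁻¹) atTop (nhdsWithin 0 (Ioi 0)) := by
  refine tendsto_nhdsWithin_iff.2 ⟨?_, ?_⟩
  · simpa using tendsto_rpow_neg_atTop (y := -b⁻¹) (by simpa using hb)
  · filter_upwards [eventually_gt_atTop 0] with y hy using Real.rpow_pos_of_pos hy _

/-- Logarithmic equivalence of `P` with `a * x ^ b` as two-sided bounds where `x ^ b` is large. -/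
theorem exists_bounds_log_of_tendsto {a b : ℝ} {P : ℝ → ℝ} (ha : a ≠ 0) (hb0 : b ≠ 0)
    (hpos : 0 < b → Tendsto (fun x => Real.log (P x) / (a * x ^ b)) atTop (nhds 1))
    (hneg : b < 0 → Tendsto (fun x => Real.log (P x) / (a * x ^ b))
      (nhdsWithin 0 (Ioi 0)) (nhds 1)) {ε : ℝ} (hε : 0 < ε) :
    ∃ T > 0, ∀ x > 0, T ≤ x ^ b →
      (a - ε) * x ^ b ≤ Real.log (P x) ∧ Real.log (P x) ≤ (a + ε) * x ^ b := by
  have hlim : Tendsto (fun y : ℝ => Real.log (P (y ^ b⁻¹)) / (a * (y ^ b⁻¹) ^ b)) atTop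
      (nhds 1) := by
    rcases hb0.lt_or_gt with hb | hb
    · exact (hneg hb).comp (tendsto_rpow_inv_atTop_nhdsGT_zero hb)
    · exact (hpos hb).comp (tendsto_rpow_inv_atTop_atTop hb)
  have hev := (hlim.const_mul a).eventually (Metric.ball_mem_nhds _ hε)
  obtain ⟨N, hN⟩ := eventually_atTop.1 hev
  refine ⟨max N 1, by positivity, fun x hx hxT => ?_⟩
  have h := hN (x ^ b) ((le_max_left _ _).trans hxT)
  rw [Real.rpow_rpow_inv hx.le hb0] at h
  have hxb : 0 < x ^ b := Real.rpow_pos_of_pos hx b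
  have heq : a * (Real.log (P x) / (a * x ^ b)) = Real.log (P x) / x ^ b := by field_simp
  rw [heq, Real.dist_eq, mul_one, abs_lt] at h
  constructor
  · rw [← le_div_iff₀ hxb]; linarith
  · rw [← div_le_iff₀ hxb]; linarith

theorem rpow_mul_self_eq_rpow_inv {b s : ℝ} (hb0 : b ≠ 0) (hb1 : b ≠ 1) (hs : 0 < s) :
    s ^ (b / (1 - b)) * s = (s ^ (b / (1 - b))) ^ b⁻¹ := by
  have hb : 1 - b ≠ 0 := sub_ne_zero.2 hb1.symm
  nth_rewrite 2 [← Real.rpow_one s]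
  rw [← Real.rpow_mul hs.le, ← Real.rpow_add hs]
  congr 1
  field_simp
  ring

/-- The scaling `u = v * s ^ (b / (1 - b))` turns `(u * s) ^ b` into a multiple of `v ^ b`. -/
theorem mul_rpow_eq_div_rpow_mul {b s u : ℝ} (hb0 : b ≠ 0) (hb1 : b ≠ 1) (hs : 0 < s)
    (hu : 0 < u) :
    (u * s) ^ b = (u / s ^ (b / (1 - b))) ^ b * s ^ (b / (1 - b)) := by
  have hL : 0 < s ^ (b / (1 - b)) := Real.rpow_pos_of_pos hs _
  have h : u * s = u / s ^ (b / (1 - b)) * (s ^ (b / (1 - b)) * s) := by field_simp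
  rw [h, rpow_mul_self_eq_rpow_inv hb0 hb1 hs, Real.mul_rpow (by positivity) (by positivity),
    Real.rpow_inv_rpow hL.le hb0]

theorem eventually_exp_le_integral {a b c ε : ℝ} {P : ℝ → ℝ} {p : Filter ℝ}
    (hb0 : b ≠ 0) (hb1 : b ≠ 1) (habc : a * b * c < 0) (hPpos : ∀ x > 0, 0 < P x)
    (hf : ∀ s > 0, IntegrableOn (fun u => P (u * s) * Real.exp (c * u)) (Ioi 0))
    (hP : ∀ ε > 0, ∃ T > 0, ∀ x > 0, T ≤ x ^ b →
      (a - ε) * x ^ b ≤ Real.log (P x) ∧ Real.log (P x) ≤ (a + ε) * x ^ b)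
    (hp : ∀ᶠ s in p, 0 < s) (hL : Tendsto (fun s : ℝ => s ^ (b / (1 - b))) p atTop)
    (hε : 0 < ε) :
    ∀ᶠ s in p, Real.exp ((a * (1 - b) * (-a * b / c) ^ (b / (1 - b)) - ε) * s ^ (b / (1 - b))) ≤
      ∫ u in Ioi (0 : ℝ), P (u * s) * Real.exp (c * u) := by
  have hcrit := mul_rpow_add_mul_critical hb1 habc
  set d := a * (1 - b) * (-a * b / c) ^ (b / (1 - b))
  set m := (-a * b / c) ^ (1 / (1 - b))
  have hm : 0 < m := Real.rpow_pos_of_pos (neg_mul_div_pos habc) _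
  have hmb : 0 < m ^ b := Real.rpow_pos_of_pos hm b
  set δ := ε / (2 * m ^ b) with hδ
  have hδ0 : 0 < δ := by positivity
  have hδm : δ * m ^ b = ε / 2 := by rw [hδ]; field_simp
  obtain ⟨T, hT, hbd⟩ := hP δ hδ0
  have hcont : ContinuousAt (fun v : ℝ => v ^ b) m :=
    Real.continuousAt_rpow_const _ _ (Or.inl hm.ne')
  have hcont' : ContinuousAt (fun v : ℝ => (a - δ) * v ^ b + c * v) m :=
    (hcont.const_mul _).add (continuousAt_id.const_mul _)
  have hev : ∀ᶠ v in nhds m, m ^ b / 2 < v ^ b ∧ d - ε < (a - δ) * v ^ b + c * v :=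
    (hcont.eventually (lt_mem_nhds (half_lt_self hmb))).and
      (hcont'.eventually (lt_mem_nhds (by nlinarith)))
  obtain ⟨η, hη, hball⟩ := Metric.eventually_nhds_iff.1 hev
  have hnear : ∀ v ∈ Icc m (m + η / 2),
      m ^ b / 2 < v ^ b ∧ d - ε < (a - δ) * v ^ b + c * v := fun v hv =>
    hball (by rw [Real.dist_eq, abs_lt]; constructor <;> linarith [hv.1, hv.2])
  filter_upwards [hp, hL.eventually_ge_atTop (2 / η), hL.eventually_ge_atTop (T / (m ^ b / 2))]
    with s hs hLη hLT
  have hscale (u : ℝ) (hu : 0 < u) := mul_rpow_eq_div_rpow_mul hb0 hb1 hs hu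
  have hL0 : 0 < s ^ (b / (1 - b)) := Real.rpow_pos_of_pos hs _
  generalize s ^ (b / (1 - b)) = L at *
  have hsub : Icc (m * L) ((m + η / 2) * L) ⊆ Ioi 0 := fun u hu =>
    (mul_pos hm hL0).trans_le hu.1
  have hlow : ∀ u ∈ Icc (m * L) ((m + η / 2) * L),
      Real.exp ((d - ε) * L) ≤ P (u * s) * Real.exp (c * u) := by
    intro u hu
    have hu0 : 0 < u := hsub hu
    have hv : u / L ∈ Icc m (m + η / 2) :=
      ⟨(le_div_iff₀ hL0).2 hu.1, (div_le_iff₀ hL0).2 hu.2⟩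
    obtain ⟨h1, h2⟩ := hnear _ hv
    have hTle : T ≤ (u * s) ^ b := by
      rw [hscale u hu0]
      rw [div_le_iff₀ (by positivity)] at hLT
      nlinarith
    have h3 := (hbd (u * s) (by positivity) hTle).1
    rw [← Real.exp_log (hPpos (u * s) (by positivity)), ← Real.exp_add, Real.exp_le_exp]
    rw [hscale u hu0] at h3
    have h4 : c * u = c * (u / L) * L := by field_simp
    nlinarith
  have hvol : volume.real (Icc (m * L) ((m + η / 2) * L)) = η / 2 * L := by
    rw [Real.volume_real_Icc_of_le (by nlinarith)]
    ring
  calc Real.exp ((d - ε) * L) ≤ Real.exp ((d - ε) * L) * (η / 2 * L) := by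
        refine le_mul_of_one_le_right (Real.exp_pos _).le ?_
        rw [div_le_iff₀ hη] at hLη
        linarith
    _ ≤ ∫ u in Icc (m * L) ((m + η / 2) * L), P (u * s) * Real.exp (c * u) := by
        rw [← hvol]
        exact setIntegral_ge_of_const_le_real measurableSet_Icc (by simp) hlow
          ((hf s hs).mono_set hsub)
    _ ≤ ∫ u in Ioi (0 : ℝ), P (u * s) * Real.exp (c * u) := by
        refine setIntegral_mono_set (hf s hs) ?_ hsub.eventuallyLE
        filter_upwards [ae_restrict_mem measurableSet_Ioi] with u hu
        exact (mul_pos (hPpos _ (mul_pos hu hs)) (Real.exp_pos _)).le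

/-- Off the region where `x ^ b` is large, the exponential weight is negligible. -/
theorem eventually_mul_le_of_rpow_lt {b c d T : ℝ} {p : Filter ℝ}
    (hb0 : b ≠ 0) (hb1 : b ≠ 1) (hT : 0 < T) (hd : 0 < b → 0 < d) (hc : b < 0 → c < 0)
    (hp : ∀ᶠ s in p, 0 < s) (hL : Tendsto (fun s : ℝ => s ^ (b / (1 - b))) p atTop) :
    ∀ᶠ s in p, ∀ u > 0, (u * s) ^ b < T → c * u ≤ d * s ^ (b / (1 - b)) := by
  have hθ : 0 < T ^ b⁻¹ := Real.rpow_pos_of_pos hT _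
  rcases hb0.lt_or_gt with hb | hb
  · have hlim := ((tendsto_nhdsWithin_iff.1 (tendsto_rpow_inv_atTop_nhdsGT_zero hb)).1.comp
      hL).const_mul d
    rw [mul_zero] at hlim
    filter_upwards [hp, hlim.eventually (lt_mem_nhds (mul_neg_of_neg_of_pos (hc hb) hθ))]
      with s hs h u hu hbad
    have h1 : T ^ b⁻¹ < u * s := (Real.rpow_inv_lt_iff_of_neg hT (by positivity) hb).2 hbad
    rw [Function.comp_apply, ← rpow_mul_self_eq_rpow_inv hb0 hb1 hs] at h
    have := hc hb
    refine le_of_mul_le_mul_right ?_ hs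
    nlinarith
  · have hlim := ((tendsto_rpow_inv_atTop_atTop hb).comp hL).const_mul_atTop (hd hb)
    filter_upwards [hp, hlim.eventually_ge_atTop (|c| * T ^ b⁻¹)] with s hs h u hu hbad
    have h1 : u * s < T ^ b⁻¹ := (Real.lt_rpow_inv_iff_of_pos (by positivity) hT.le hb).2 hbad
    rw [Function.comp_apply, ← rpow_mul_self_eq_rpow_inv hb0 hb1 hs] at h
    refine le_of_mul_le_mul_right ?_ hs
    have h2 : c * (u * s) ≤ |c| * (u * s) :=
      mul_le_mul_of_nonneg_right (le_abs_self c) (by positivity)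
    have h3 := mul_le_mul_of_nonneg_left h1.le (abs_nonneg c)
    nlinarith

theorem integrableOn_indicator_rpow_lt {b T : ℝ} {P : ℝ → ℝ} (hb0 : b ≠ 0) (hT : 0 < T)
    (hPint : ∀ r > 0, IntegrableOn P (Ioc 0 r)) (hPint' : b < 0 → IntegrableOn P (Ioi 0)) :
    IntegrableOn ({x : ℝ | x ^ b < T}.indicator P) (Ioi 0) := by
  have hmeas : MeasurableSet {x : ℝ | x ^ b < T} :=
    measurableSet_lt (measurable_id.pow_const b) measurable_const
  rw [IntegrableOn, integrable_indicator_iff hmeas, IntegrableOn, Measure.restrict_restrict hmeas]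
  change IntegrableOn P _ _
  rcases hb0.lt_or_gt with hb | hb
  · exact (hPint' hb).mono_set inter_subset_right
  · refine (hPint (T ^ b⁻¹) (Real.rpow_pos_of_pos hT _)).mono_set ?_
    rintro x ⟨hx, hx0⟩
    exact ⟨hx0, ((Real.lt_rpow_inv_iff_of_pos (le_of_lt hx0) hT.le hb).2 hx).le⟩

theorem eventually_const_add_mul_inv_le_exp {b ε : ℝ} {p : Filter ℝ} (hb0 : b ≠ 0) (hb1 : b ≠ 1)
    (hp : ∀ᶠ s in p, 0 < s) (hL : Tendsto (fun s : ℝ => s ^ (b / (1 - b))) p atTop)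
    (hε : 0 < ε) (K C : ℝ) :
    ∀ᶠ s in p, K + C * s⁻¹ ≤ Real.exp (ε * s ^ (b / (1 - b))) := by
  have hb : 1 - b ≠ 0 := sub_ne_zero.2 hb1.symm
  have hlim (q : ℝ) := tendsto_rpow_mul_exp_neg_mul_atTop_nhds_zero q ε hε
  have h := (((hlim 0).const_mul K).add ((hlim (-(b / (1 - b))⁻¹)).const_mul C)).comp hL
  have h0 : K * 0 + C * 0 < 1 := by norm_num
  filter_upwards [hp, h.eventually (gt_mem_nhds h0)] with s hs hlt
  have hinv : (s ^ (b / (1 - b))) ^ (-(b / (1 - b))⁻¹) = s⁻¹ := by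
    rw [← Real.rpow_mul hs.le, mul_neg, mul_inv_cancel₀ (div_ne_zero hb0 hb), Real.rpow_neg_one]
  simp only [Function.comp_apply, hinv, Real.rpow_zero] at hlt
  have hexp : Real.exp (ε * s ^ (b / (1 - b))) * Real.exp (-ε * s ^ (b / (1 - b))) = 1 := by
    rw [← Real.exp_add]; simp
  have hpos := Real.exp_pos (ε * s ^ (b / (1 - b)))
  calc K + C * s⁻¹ = Real.exp (ε * s ^ (b / (1 - b))) *
        (K * (1 * Real.exp (-ε * s ^ (b / (1 - b)))) +
          C * (s⁻¹ * Real.exp (-ε * s ^ (b / (1 - b))))) := by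
        linear_combination (-(K + C * s⁻¹)) * hexp
    _ ≤ Real.exp (ε * s ^ (b / (1 - b))) := mul_le_of_le_one_right hpos.le hlt.le

/-- The slopes of the concave function `x ↦ a * x ^ b + c * x` can be increased slightly without
changing its maximum much. -/
theorem exists_pos_perturbation {a b c ε : ℝ} (hab : a * b * (b - 1) < 0)
    (habc : a * b * c < 0) (hε : 0 < ε) :
    ∃ δ > 0, (a + δ) * b * (b - 1) < 0 ∧ (a + δ) * b * (c + δ) < 0 ∧
      (a + δ) * (1 - b) * (-(a + δ) * b / (c + δ)) ^ (b / (1 - b)) <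
        a * (1 - b) * (-a * b / c) ^ (b / (1 - b)) + ε := by
  have hc : c ≠ 0 := by rintro rfl; simp at habc
  have hy := neg_mul_div_pos habc
  have h1 : ContinuousAt (fun δ : ℝ => (a + δ) * b * (b - 1)) 0 := by fun_prop
  have h2 : ContinuousAt (fun δ : ℝ => (a + δ) * b * (c + δ)) 0 := by fun_prop
  have h3 : ContinuousAt (fun δ : ℝ =>
      (a + δ) * (1 - b) * (-(a + δ) * b / (c + δ)) ^ (b / (1 - b))) 0 := by
    refine ContinuousAt.mul (by fun_prop) (ContinuousAt.rpow_const ?_ (Or.inl ?_))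
    · exact ContinuousAt.div (by fun_prop) (by fun_prop) (by simpa using hc)
    · simpa using hy.ne'
  have hev := (h1.eventually_lt_const (u := 0) (by simpa using hab)).and
    ((h2.eventually_lt_const (u := 0) (by simpa using habc)).and
    (h3.eventually_lt_const (u := a * (1 - b) * (-a * b / c) ^ (b / (1 - b)) + ε)
      (by simpa using hε)))
  obtain ⟨δ, hδ, hδ0⟩ := ((hev.filter_mono nhdsWithin_le_nhds).and
    (self_mem_nhdsWithin (s := Ioi (0 : ℝ)))).exists
  exact ⟨δ, hδ0, hδ⟩

theorem eventually_add_integral_le_exp {a b c A ε : ℝ} {P : ℝ → ℝ} {p : Filter ℝ}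
    (hb0 : b ≠ 0) (hb1 : b ≠ 1) (hab : a * b * (b - 1) < 0) (habc : a * b * c < 0)
    (hPpos : ∀ x > 0, 0 < P x)
    (hPint : ∀ r > 0, IntegrableOn P (Ioc 0 r)) (hPint' : b < 0 → IntegrableOn P (Ioi 0))
    (hd : 0 < b → 0 < a * (1 - b) * (-a * b / c) ^ (b / (1 - b))) (hc : b < 0 → c < 0)
    (hA : 0 ≤ A) (hAd : a * (1 - b) * (-a * b / c) ^ (b / (1 - b)) < 0 → A = 0)
    (hf : ∀ s > 0, IntegrableOn (fun u => P (u * s) * Real.exp (c * u)) (Ioi 0))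
    (hP : ∀ ε > 0, ∃ T > 0, ∀ x > 0, T ≤ x ^ b →
      (a - ε) * x ^ b ≤ Real.log (P x) ∧ Real.log (P x) ≤ (a + ε) * x ^ b)
    (hp : ∀ᶠ s in p, 0 < s) (hL : Tendsto (fun s : ℝ => s ^ (b / (1 - b))) p atTop)
    (hε : 0 < ε) :
    ∀ᶠ s in p, A + ∫ u in Ioi (0 : ℝ), P (u * s) * Real.exp (c * u) ≤
      Real.exp ((a * (1 - b) * (-a * b / c) ^ (b / (1 - b)) + ε) * s ^ (b / (1 - b))) := by
  obtain ⟨δ, hδ, hab', habc', hdδ⟩ := exists_pos_perturbation hab habc (half_pos hε)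
  have hmax (v : ℝ) (hv : 0 < v) := (mul_rpow_add_mul_le hb1 hab' habc' hv).trans hdδ.le
  set d := a * (1 - b) * (-a * b / c) ^ (b / (1 - b))
  obtain ⟨T, hT, hbd⟩ := hP δ hδ
  set Q := {x : ℝ | x ^ b < T}.indicator P with hQ
  have hQint : IntegrableOn Q (Ioi 0) := integrableOn_indicator_rpow_lt hb0 hT hPint hPint'
  filter_upwards [hp, eventually_mul_le_of_rpow_lt hb0 hb1 hT hd hc hp hL,
    eventually_const_add_mul_inv_le_exp hb0 hb1 hp hL (half_pos hε) (A + 1 / δ)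
      (∫ x in Ioi (0 : ℝ), Q x)] with s hs hfar hpre
  have hscale (u : ℝ) (hu : 0 < u) := mul_rpow_eq_div_rpow_mul hb0 hb1 hs hu
  have hL0 : 0 < s ^ (b / (1 - b)) := Real.rpow_pos_of_pos hs _
  generalize s ^ (b / (1 - b)) = L at *
  have hexp0 := Real.exp_pos ((d + ε / 2) * L)
  have hpt : ∀ u ∈ Ioi (0 : ℝ), P (u * s) * Real.exp (c * u) ≤
      Real.exp ((d + ε / 2) * L) * (Real.exp (-δ * u) + Q (u * s)) := by
    intro u (hu : 0 < u)
    have hus : 0 < u * s := mul_pos hu hs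
    have hPus := hPpos _ hus
    by_cases hbad : (u * s) ^ b < T
    · have hQu : Q (u * s) = P (u * s) := indicator_of_mem (by exact hbad) P
      have h1 : Real.exp (c * u) ≤ Real.exp ((d + ε / 2) * L) :=
        Real.exp_le_exp.2 ((hfar u hu hbad).trans (by nlinarith))
      rw [hQu]
      nlinarith [mul_le_mul_of_nonneg_left h1 hPus.le,
        mul_pos hexp0 (Real.exp_pos (-δ * u))]
    · have hQu : Q (u * s) = 0 := indicator_of_notMem (by exact hbad) P
      have h1 := (hbd _ hus (not_lt.1 hbad)).2
      have h2 := mul_le_mul_of_nonneg_right (hmax (u / L) (div_pos hu hL0)) hL0.le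
      rw [hQu, add_zero, ← Real.exp_add, ← Real.exp_log hPus, ← Real.exp_add, Real.exp_le_exp]
      rw [hscale u hu] at h1
      have h3 : (c + δ) * (u / L) * L = (c + δ) * u := by field_simp
      nlinarith
  have hQs : IntegrableOn (fun u => Q (u * s)) (Ioi 0) :=
    (integrableOn_Ioi_comp_mul_right_iff Q 0 hs).2 (by simpa using hQint)
  have hexpint : IntegrableOn (fun u => Real.exp (-δ * u)) (Ioi 0) :=
    integrableOn_exp_mul_Ioi (neg_lt_zero.2 hδ) 0
  have hint : ∫ u in Ioi (0 : ℝ), P (u * s) * Real.exp (c * u) ≤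
      Real.exp ((d + ε / 2) * L) * (1 / δ + (∫ x in Ioi (0 : ℝ), Q x) * s⁻¹) := by
    refine (setIntegral_mono_on (hf s hs) ((hexpint.add hQs).const_mul _)
      measurableSet_Ioi hpt).trans_eq ?_
    simp only [Pi.add_apply]
    rw [integral_const_mul, integral_add hexpint hQs, integral_exp_mul_Ioi (neg_lt_zero.2 hδ),
      integral_comp_mul_right_Ioi Q 0 hs]
    simp [mul_comm]
  have hAle : A ≤ Real.exp ((d + ε / 2) * L) * A := by
    rcases lt_or_ge d 0 with hneg | hnonneg
    · simp [hAd hneg]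
    · exact le_mul_of_one_le_left hA (Real.one_le_exp (by positivity))
  calc A + ∫ u in Ioi (0 : ℝ), P (u * s) * Real.exp (c * u)
      ≤ Real.exp ((d + ε / 2) * L) * (A + 1 / δ + (∫ x in Ioi (0 : ℝ), Q x) * s⁻¹) := by
        linarith
    _ ≤ Real.exp ((d + ε / 2) * L) * Real.exp (ε / 2 * L) :=
        mul_le_mul_of_nonneg_left hpre hexp0.le
    _ = Real.exp ((d + ε) * L) := by rw [← Real.exp_add]; ring_nf

theorem tendsto_log_div_of_eventually_exp_bounds {p : Filter ℝ} {F G : ℝ → ℝ} {d : ℝ}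
    (hd : d ≠ 0) (hG : ∀ᶠ s in p, 0 < G s)
    (hlow : ∀ ε > 0, ∀ᶠ s in p, Real.exp ((d - ε) * G s) ≤ F s)
    (hup : ∀ ε > 0, ∀ᶠ s in p, F s ≤ Real.exp ((d + ε) * G s)) :
    Tendsto (fun s => Real.log (F s) / (d * G s)) p (nhds 1) := by
  have hlim : Tendsto (fun s => Real.log (F s) / G s) p (nhds d) := by
    refine Metric.tendsto_nhds.2 fun ε hε => ?_
    filter_upwards [hG, hlow _ (half_pos hε), hup _ (half_pos hε)] with s hs h1 h2
    have hF : 0 < F s := (Real.exp_pos _).trans_le h1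
    have h3 := (le_div_iff₀ hs).2 ((Real.le_log_iff_exp_le hF).2 h1)
    have h4 := (div_le_iff₀ hs).2 ((Real.log_le_iff_le_exp hF).2 h2)
    rw [Real.dist_eq, abs_lt]
    constructor <;> linarith
  have h := hlim.div_const d
  rw [div_self hd] at h
  refine h.congr fun s => ?_
  rw [div_div, mul_comm]

/-- Main Tauberian theorem, necessity: Condition (1) implies Condition (2). -/
theorem main_tauberian_necessity (a b c d A : ℝ) (P : ℝ → ℝ)
    (hb0 : b ≠ 0) (hb1 : b ≠ 1)
    (habb : a * b * (b - 1) < 0) (habc : a * b * c < 0)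
    (hd : d = a * (1 - b) * (-a * b / c) ^ (b / (1 - b)))
    (hPmeas : Measurable P) (hPpos : ∀ x > 0, 0 < P x)
    (hPint : ∀ r > 0, IntegrableOn P (Ioc 0 r))
    (hPint' : b < 0 → IntegrableOn P (Ioi 0))
    (hA : 0 ≤ A) (hAd : d < 0 → A = 0)
    (hf : ∀ s > 0, IntegrableOn (fun u => P (u * s) * Real.exp (c * u)) (Ioi 0)) :
    (((0 < b → Tendsto (fun x => Real.log (P x) / (a * x ^ b)) atTop (nhds 1)) ∧
      (b < 0 → Tendsto (fun x => Real.log (P x) / (a * x ^ b))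
          (nhdsWithin 0 (Ioi 0)) (nhds 1)))
    →
     ((0 < b / (1 - b) →
        Tendsto (fun l => Real.log (A + ∫ u in Ioi (0:ℝ), P (u * l) * Real.exp (c * u)) /
          (d * l ^ (b / (1 - b)))) atTop (nhds 1)) ∧
      (b / (1 - b) < 0 →
        Tendsto (fun l => Real.log (A + ∫ u in Ioi (0:ℝ), P (u * l) * Real.exp (c * u)) /
          (d * l ^ (b / (1 - b)))) (nhdsWithin 0 (Ioi 0)) (nhds 1)))) := by
  rintro ⟨hpos, hneg⟩
  subst hd
  have ha : a ≠ 0 := by rintro rfl; simp at habc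
  have hy : 0 < (-a * b / c) ^ (b / (1 - b)) := Real.rpow_pos_of_pos (neg_mul_div_pos habc) _
  have hd0 : a * (1 - b) * (-a * b / c) ^ (b / (1 - b)) ≠ 0 :=
    mul_ne_zero (mul_ne_zero ha (sub_ne_zero.2 hb1.symm)) hy.ne'
  have hdpos : 0 < b → 0 < a * (1 - b) * (-a * b / c) ^ (b / (1 - b)) := fun hb =>
    mul_pos (by by_contra! h; nlinarith) hy
  have hc : b < 0 → c < 0 := by
    intro hb
    have hab : 0 < a * b := by by_contra! h; nlinarith
    by_contra! h
    nlinarith [mul_nonneg hab.le h]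
  have hP : ∀ ε > 0, ∃ T > 0, ∀ x > 0, T ≤ x ^ b →
      (a - ε) * x ^ b ≤ Real.log (P x) ∧ Real.log (P x) ≤ (a + ε) * x ^ b := fun ε hε =>
    exists_bounds_log_of_tendsto ha hb0 hpos hneg hε
  have main {p : Filter ℝ} (hp : ∀ᶠ s in p, 0 < s)
      (hL : Tendsto (fun s : ℝ => s ^ (b / (1 - b))) p atTop) :=
    tendsto_log_div_of_eventually_exp_bounds hd0
      (F := fun l => A + ∫ u in Ioi (0 : ℝ), P (u * l) * Real.exp (c * u))
      (hL.eventually_gt_atTop 0)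
      (fun ε hε => (eventually_exp_le_integral hb0 hb1 habc hPpos hf hP hp hL hε).mono
        fun s hs => hs.trans (le_add_of_nonneg_left hA))
      (fun ε hε => eventually_add_integral_le_exp hb0 hb1 habb habc hPpos hPint hPint' hdpos hc hA
        hAd hf hP hp hL hε)
  exact ⟨fun hβ => main (eventually_gt_atTop 0) (tendsto_rpow_atTop hβ),
    fun hβ => main self_mem_nhdsWithin (tendsto_rpow_neg_nhdsGT_zero hβ)⟩
end

section
/- (Kohlbecker's Tauberian theorem.) log(μ[0,x]) / (B x^{1/α}) → 1 as x → ∞ if and only if log(M(λ)) / ((α−1)(B/α)^{α/(α−1)} λ^{1/(α−1)}) → 1 as λ → ∞. -/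
open Real Filter MeasureTheory Set

/-- Passing from a power-law normalisation to the power substitution `x = s ^ a`. -/
lemma tendsto_div_mul_rpow_iff (f : ℝ → ℝ) {a D : ℝ} (ha : 0 < a) (hD : 0 < D) :
    Tendsto (fun x => f x / (D * x ^ (1 / a))) atTop (nhds 1) ↔
      Tendsto (fun s => f (s ^ a) / s) atTop (nhds D) := by
  constructor
  · intro h
    have h' := (h.comp (tendsto_rpow_atTop ha)).const_mul D
    rw [mul_one] at h'
    refine h'.congr' ?_
    filter_upwards [eventually_gt_atTop 0] with s hs
    have : (s ^ a) ^ (1 / a) = s := by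
      rw [← rpow_mul hs.le, mul_one_div_cancel ha.ne', rpow_one]
    simp only [Function.comp_apply, this]
    field_simp
  · intro h
    have h' := (h.comp (tendsto_rpow_atTop (one_div_pos.2 ha))).const_mul D⁻¹
    rw [inv_mul_cancel₀ hD.ne'] at h'
    refine h'.congr' ?_
    filter_upwards [eventually_gt_atTop 0] with x hx
    have : (x ^ (1 / a)) ^ a = x := by
      rw [← rpow_mul hx.le, one_div_mul_cancel ha.ne', rpow_one]
    simp only [Function.comp_apply, this]
    field_simp

lemma tendsto_comp_rpow_div {f : ℝ → ℝ} {a C t : ℝ} (ha : 0 < a) (ht : 0 < t)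
    (h : Tendsto (fun s => f (s ^ a) / s) atTop (nhds C)) :
    Tendsto (fun s => f (s ^ a / t) / s) atTop (nhds (C * t ^ (-(1 / a)))) := by
  have hc : 0 < t ^ (-(1 / a)) := rpow_pos_of_pos ht _
  have h' := (h.comp (tendsto_id.atTop_mul_const hc)).mul_const (t ^ (-(1 / a)))
  refine h'.congr' ?_
  filter_upwards [eventually_gt_atTop 0] with s hs
  have : (s * t ^ (-(1 / a))) ^ a = s ^ a / t := by
    rw [mul_rpow hs.le hc.le, ← rpow_mul ht.le, neg_mul, one_div_mul_cancel ha.ne', rpow_neg_one,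
      div_eq_mul_inv]
  simp only [Function.comp_apply, id, this]
  field_simp

/-- The tangent-line bound for `B * x ^ (1 / α)`, with the slope `1 / s ^ (α - 1)`. -/
lemma mul_rpow_le_add_div {α B s x : ℝ} (hα : 1 < α) (hB : 0 < B) (hs : 0 < s) (hx : 0 ≤ x) :
    B * x ^ (1 / α) ≤ (α - 1) * (B / α) ^ (α / (α - 1)) * s + x / s ^ (α - 1) := by
  have hα0 : 0 < α := by linarith
  have hb : 0 < B / α := by positivity
  set c := (B / α) ^ (1 / (α - 1)) with hc
  have hc0 : 0 < c := rpow_pos_of_pos hb _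
  have hca : c ^ (α - 1) = B / α := by
    rw [hc, ← rpow_mul hb.le, one_div_mul_cancel (by linarith), rpow_one]
  have hy : (B / α) ^ (α / (α - 1)) = c * (B / α) := by
    rw [hc, ← rpow_add_one hb.ne']
    congr 1
    have : α - 1 ≠ 0 := by linarith
    field_simp
    ring
  set r := c * s with hr
  have hr0 : 0 < r := by positivity
  have hrs : r ^ α = c * s * (B / α * s ^ (α - 1)) := by
    rw [← hca, ← mul_rpow hc0.le hs.le, ← hr, ← rpow_one_add' hr0.le (by linarith)]
    congr 1; ring
  have hsa : 0 < s ^ (α - 1) := rpow_pos_of_pos hs _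
  have hra : 0 < r ^ α := rpow_pos_of_pos hr0 _
  have key : (1 + (x / r ^ α - 1)) ^ (1 / α) ≤ 1 + 1 / α * (x / r ^ α - 1) :=
    rpow_one_add_le_one_add_mul_self (by linarith [div_nonneg hx hra.le]) (by positivity)
      ((div_le_one hα0).2 hα.le)
  rw [add_sub_cancel, div_rpow hx hra.le, ← rpow_mul hr0.le, mul_one_div_cancel hα0.ne',
    rpow_one, div_le_iff₀ hr0] at key
  calc B * x ^ (1 / α) ≤ B * ((1 + 1 / α * (x / r ^ α - 1)) * r) := by gcongr
    _ = _ := by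
      rw [hrs, hy, hr]
      field_simp
      ring

lemma exp_mul_measure_Icc_le_integral {μ : Measure ℝ} {l : ℝ} (hl : 0 < l) (X : ℝ)
    (hX : μ (Icc 0 X) < ⊤) (hM : Integrable (fun x => exp (-x / l)) μ) :
    exp (-X / l) * (μ (Icc 0 X)).toReal ≤ ∫ x, exp (-x / l) ∂μ := by
  have hI : Integrable ((Icc 0 X).indicator fun _ => exp (-X / l)) μ :=
    (integrable_indicator_iff measurableSet_Icc).2 (integrableOn_const hX.ne)
  have := integral_mono hI hM (fun x => by
    by_cases hx : x ∈ Icc 0 X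
    · simp only [indicator_of_mem hx]
      have := hx.2
      gcongr
    · simp only [indicator_of_notMem hx]
      positivity)
  rw [integral_indicator measurableSet_Icc, setIntegral_const, smul_eq_mul] at this
  rwa [mul_comm]

/-- Splitting a Laplace transform at `Z` and `X`, with exponential Markov bounds on both tails. -/
lemma integral_exp_le_of_split {μ : Measure ℝ} (hsupp : μ (Iio 0) = 0) {l l₁ l₂ X Z : ℝ}
    (h1 : 1 / l₁ ≤ 1 / l) (h2 : 1 / l ≤ 1 / l₂) (hX : μ (Icc 0 X) < ⊤)
    (hl : 0 < l)
    (hM : Integrable (fun x => exp (-x / l)) μ) (hM₁ : Integrable (fun x => exp (-x / l₁)) μ)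
    (hM₂ : Integrable (fun x => exp (-x / l₂)) μ) :
    ∫ x, exp (-x / l) ∂μ ≤ exp (Z * (1 / l₂ - 1 / l)) * ∫ x, exp (-x / l₂) ∂μ
      + exp (-Z / l) * (μ (Icc 0 X)).toReal
      + exp (-(X * (1 / l - 1 / l₁))) * ∫ x, exp (-x / l₁) ∂μ := by
  have hI : Integrable ((Icc 0 X).indicator fun _ => exp (-Z / l)) μ :=
    (integrable_indicator_iff measurableSet_Icc).2 (integrableOn_const hX.ne)
  have hae : ∀ᵐ x ∂μ, 0 ≤ x := by
    rw [ae_iff]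
    simpa [Iio] using hsupp
  have := integral_mono_ae hM (((hM₂.const_mul (exp (Z * (1 / l₂ - 1 / l)))).add hI).add
    (hM₁.const_mul (exp (-(X * (1 / l - 1 / l₁)))))) (by
    filter_upwards [hae] with x hx
    simp only [Pi.add_apply]
    have hi : 0 ≤ (Icc 0 X).indicator (fun _ => exp (-Z / l)) x :=
      indicator_nonneg (fun _ _ => (exp_pos _).le) _
    have e1 : 0 ≤ exp (Z * (1 / l₂ - 1 / l)) * exp (-x / l₂) := by positivity
    have e2 : 0 ≤ exp (-(X * (1 / l - 1 / l₁))) * exp (-x / l₁) := by positivity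
    rcases le_or_gt x Z with hZ | hZ
    · have : exp (-x / l) ≤ exp (Z * (1 / l₂ - 1 / l)) * exp (-x / l₂) := by
        rw [← exp_add]
        apply exp_le_exp.2
        have := mul_le_mul_of_nonneg_right hZ (sub_nonneg.2 h2)
        have a1 : -x / l = -(x * (1 / l)) := by ring
        have a2 : -x / l₂ = -(x * (1 / l₂)) := by ring
        rw [a1, a2]
        linarith
      linarith
    · rcases le_or_gt x X with hxX | hxX
      · have : exp (-x / l) ≤ (Icc 0 X).indicator (fun _ => exp (-Z / l)) x := by
          rw [indicator_of_mem (mem_Icc.2 ⟨hx, hxX⟩)]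
          gcongr
        linarith
      · have : exp (-x / l) ≤ exp (-(X * (1 / l - 1 / l₁))) * exp (-x / l₁) := by
          rw [← exp_add]
          apply exp_le_exp.2
          have := mul_le_mul_of_nonneg_right hxX.le (sub_nonneg.2 h1)
          have a1 : -x / l = -(x * (1 / l)) := by ring
          have a2 : -x / l₁ = -(x * (1 / l₁)) := by ring
          rw [a1, a2]
          linarith
        linarith)
  rw [integral_add' ((hM₂.const_mul _).add hI) (hM₁.const_mul _),
    integral_add' (hM₂.const_mul _) hI, integral_const_mul, integral_const_mul,
    integral_indicator measurableSet_Icc, setIntegral_const, smul_eq_mul,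
    mul_comm (μ.real _)] at this
  exact this

/-- If `μ [0, x]` grows at most like `exp (b * x ^ (1 / α))`, then `exp (-b' * x ^ (1 / α))` is
integrable for `b < b'`. -/
lemma integrable_exp_neg_mul_rpow {μ : Measure ℝ} (hsupp : μ (Iio 0) = 0) {α b b' K : ℝ}
    (hα : 0 < α) (hb' : 0 ≤ b') (hb : b < b')
    (hN : ∀ s : ℝ, 0 ≤ s → μ (Icc 0 (s ^ α)) ≤ ENNReal.ofReal (K * exp (b * s))) :
    Integrable (fun x => exp (-(b' * x ^ (1 / α)))) μ := by
  have hmeas : Measurable fun x : ℝ => exp (-(b' * x ^ (1 / α))) := by fun_prop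
  refine ⟨hmeas.aestronglyMeasurable, ?_⟩
  rw [hasFiniteIntegral_iff_ofReal (ae_of_all _ fun _ => (exp_pos _).le)]
  set S : ℕ → Set ℝ := fun k => Icc ((k : ℝ) ^ α) (((k + 1 : ℕ) : ℝ) ^ α) with hS
  have hcover : Ici (0 : ℝ) ⊆ ⋃ k, S k := by
    intro x hx
    have hx : 0 ≤ x := hx
    have hx1 : (x ^ (1 / α)) ^ α = x := by
      rw [← rpow_mul hx, one_div_mul_cancel hα.ne', rpow_one]
    refine mem_iUnion.2 ⟨⌊x ^ (1 / α)⌋₊, ?_, ?_⟩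
    · calc _ ≤ (x ^ (1 / α)) ^ α := by
            gcongr
            exact Nat.floor_le (by positivity)
        _ = x := hx1
    · calc x = (x ^ (1 / α)) ^ α := hx1.symm
        _ ≤ _ := by
            gcongr
            push_cast
            exact (Nat.lt_floor_add_one _).le
  have hr : μ.restrict (Ici 0) = μ := by
    apply Measure.restrict_eq_self_of_ae_mem
    rw [ae_iff]
    simpa [Iio] using hsupp
  have hq : exp (b - b') < 1 := by
    rw [exp_lt_one_iff]
    linarith
  have hsum : Summable fun k : ℕ => |K| * exp b * exp (b - b') ^ k :=
    (summable_geometric_of_lt_one (exp_pos _).le hq).mul_left _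
  calc ∫⁻ x, ENNReal.ofReal (exp (-(b' * x ^ (1 / α)))) ∂μ
      = ∫⁻ x in Ici 0, ENNReal.ofReal (exp (-(b' * x ^ (1 / α)))) ∂μ := by rw [hr]
    _ ≤ ∫⁻ x in ⋃ k, S k, ENNReal.ofReal (exp (-(b' * x ^ (1 / α)))) ∂μ :=
        lintegral_mono_set hcover
    _ ≤ ∑' k, ∫⁻ x in S k, ENNReal.ofReal (exp (-(b' * x ^ (1 / α)))) ∂μ :=
        lintegral_iUnion_le _ _
    _ ≤ ∑' k : ℕ, ENNReal.ofReal (|K| * exp b * exp (b - b') ^ k) := by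
        refine ENNReal.tsum_le_tsum fun k => ?_
        calc ∫⁻ x in S k, ENNReal.ofReal (exp (-(b' * x ^ (1 / α)))) ∂μ
            ≤ ∫⁻ x in S k, ENNReal.ofReal (exp (-(b' * k))) ∂μ := by
              refine setLIntegral_mono measurable_const fun x hx => ?_
              have : (k : ℝ) ≤ x ^ (1 / α) := by
                calc (k : ℝ) = ((k : ℝ) ^ α) ^ (1 / α) := by
                      rw [← rpow_mul (by positivity), mul_one_div_cancel hα.ne', rpow_one]
                  _ ≤ _ := by
                      gcongr
                      exact hx.1
              gcongr
          _ = ENNReal.ofReal (exp (-(b' * k))) * μ (S k) := setLIntegral_const _ _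
          _ ≤ ENNReal.ofReal (exp (-(b' * k))) *
                ENNReal.ofReal (|K| * exp (b * (k + 1 : ℕ))) := by
              gcongr
              refine (measure_mono (Icc_subset_Icc_left (by positivity))).trans
                ((hN _ (by positivity)).trans (ENNReal.ofReal_le_ofReal ?_))
              gcongr
              exact le_abs_self K
          _ = ENNReal.ofReal (|K| * exp b * exp (b - b') ^ k) := by
              rw [← ENNReal.ofReal_mul (exp_pos _).le, ← exp_nat_mul, mul_left_comm, mul_assoc,
                ← exp_add, ← exp_add]
              congr 3
              push_cast
              ring
    _ < ⊤ := hsum.tsum_ofReal_lt_top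

lemma exists_lt_of_hasDerivAt_pos {g : ℝ → ℝ} {g' t : ℝ} (ht : 0 < t) (hg : HasDerivAt g g' t)
    (hg' : 0 < g') : ∃ u, 0 < u ∧ u < t ∧ g u < g t := by
  have h := (hasDerivAt_iff_tendsto_slope.1 hg).eventually_const_lt hg'
  have h' : ∀ᶠ u in nhdsWithin t (Iio t), 0 < slope g t u :=
    h.filter_mono (nhdsWithin_mono _ fun u hu => ne_of_lt hu)
  obtain ⟨u, hu, hut, hu0⟩ := (h'.and (eventually_mem_nhdsWithin.and
    (mem_nhdsWithin_of_mem_nhds (Ioi_mem_nhds ht)))).exists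
  refine ⟨u, hu0, hut, ?_⟩
  have hut : u < t := hut
  rw [slope_def_field] at hu
  by_contra! hc
  exact absurd hu (not_lt.2 (div_nonpos_of_nonneg_of_nonpos (by linarith) (by linarith)))

lemma exists_gt_of_hasDerivAt_neg {g : ℝ → ℝ} {g' t : ℝ} (hg : HasDerivAt g g' t)
    (hg' : g' < 0) : ∃ u, t < u ∧ g u < g t := by
  have h := (hasDerivAt_iff_tendsto_slope.1 hg).eventually_lt_const hg'
  have h' : ∀ᶠ u in nhdsWithin t (Ioi t), slope g t u < 0 :=
    h.filter_mono (nhdsWithin_mono _ fun u hu => ne_of_gt hu)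
  obtain ⟨u, hu, hut⟩ := (h'.and self_mem_nhdsWithin).exists
  refine ⟨u, hut, ?_⟩
  have hut : t < u := hut
  rw [slope_def_field] at hu
  by_contra! hc
  exact absurd hu (not_lt.2 (div_nonneg (by linarith) (by linarith)))

/-- The Abelian half, in the variable `s` with `x = s ^ α` and `l = s ^ (α - 1)`. -/
lemma tendsto_log_laplace_of_tendsto_log_measure {μ : Measure ℝ} {α B : ℝ} (hα : 1 < α)
    (hB : 0 < B) (hsupp : μ (Iio 0) = 0) (hfin : ∀ K : Set ℝ, IsCompact K → μ K < ⊤)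
    (hμ0 : μ ≠ 0) (hM : ∀ l > 0, Integrable (fun x => exp (-x / l)) μ)
    (h : Tendsto (fun s => log (μ (Icc 0 (s ^ α))).toReal / s) atTop (nhds B)) :
    Tendsto (fun s => log (∫ x, exp (-x / s ^ (α - 1)) ∂μ) / s) atTop
      (nhds ((α - 1) * (B / α) ^ (α / (α - 1)))) := by
  have hα0 : 0 < α := by linarith
  have hα1 : 0 < α - 1 := by linarith
  have : NeZero μ := ⟨hμ0⟩
  have hMpos : ∀ l > 0, 0 < ∫ x, exp (-x / l) ∂μ := fun l hl => integral_exp_pos (hM l hl)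
  refine tendsto_order.2 ⟨fun c hc => ?_, fun c hc => ?_⟩
  · set r := (B / α) ^ (1 / (α - 1)) with hr
    have hb : 0 < B / α := by positivity
    have hr0 : 0 < r := rpow_pos_of_pos hb _
    have hra : r ^ α = (B / α) ^ (α / (α - 1)) := by
      rw [hr, ← rpow_mul hb.le]
      congr 1
      ring
    have hrr : r ^ α = r * (B / α) := by
      rw [hra, hr, ← rpow_add_one hb.ne']
      congr 1
      field_simp
      ring
    have hlim := ((h.comp (tendsto_id.atTop_mul_const hr0)).mul_const r).sub_const (r ^ α)
    have hval : B * r - r ^ α = (α - 1) * (B / α) ^ (α / (α - 1)) := by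
      rw [← hra, hrr]
      field_simp
    rw [hval] at hlim
    filter_upwards [hlim.eventually_const_lt hc, eventually_gt_atTop 0,
      (h.comp (tendsto_id.atTop_mul_const hr0)).eventually_const_lt hB] with s hs hs0 hpos
    simp only [Function.comp_apply, id] at hs hpos
    refine hs.trans_le ?_
    have hsa : 0 < s ^ (α - 1) := rpow_pos_of_pos hs0 _
    have hNpos : 0 < (μ (Icc 0 ((s * r) ^ α))).toReal := by
      refine lt_of_le_of_ne ENNReal.toReal_nonneg fun h0 => ?_
      rw [← h0] at hpos
      simp at hpos
    have hle := exp_mul_measure_Icc_le_integral hsa ((s * r) ^ α) (hfin _ isCompact_Icc)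
      (hM _ hsa)
    have hlog := log_le_log (by positivity) hle
    rw [log_mul (exp_pos _).ne' hNpos.ne', log_exp] at hlog
    have hX : -(s * r) ^ α / s ^ (α - 1) = -(r ^ α) * s := by
      rw [mul_rpow hs0.le hr0.le, rpow_sub_one hs0.ne']
      have := rpow_pos_of_pos hs0 α
      field_simp
    rw [hX] at hlog
    rw [le_div_iff₀ hs0, sub_mul]
    have : log (μ (Icc 0 ((s * r) ^ α))).toReal / (s * r) * r * s
        = log (μ (Icc 0 ((s * r) ^ α))).toReal := by
      field_simp
    linarith
  · have hcont : ContinuousAt (fun b : ℝ => (α - 1) * (b / α) ^ (α / (α - 1))) B := by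
      refine ContinuousAt.mul continuousAt_const (ContinuousAt.rpow_const (by fun_prop) (Or.inl ?_))
      positivity
    have hev : ∀ᶠ b in nhdsWithin B (Ioi B), (α - 1) * (b / α) ^ (α / (α - 1)) < c :=
      (hcont.eventually_lt_const hc).filter_mono nhdsWithin_le_nhds
    obtain ⟨b', hb'c, hb'⟩ := (hev.and self_mem_nhdsWithin).exists
    have hb' : B < b' := hb'
    obtain ⟨b, hBb, hbb'⟩ := exists_between hb'
    obtain ⟨s₀, hs₀⟩ := eventually_atTop.1
      ((h.eventually_lt_const hBb).and (eventually_gt_atTop 0))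
    set K := max 1 (μ (Icc 0 (s₀ ^ α))).toReal with hK
    have hN : ∀ s : ℝ, 0 ≤ s → μ (Icc 0 (s ^ α)) ≤ ENNReal.ofReal (K * exp (b * s)) := by
      intro s hs
      have hexp : 1 ≤ exp (b * s) := one_le_exp (by have := hB.trans hBb; positivity)
      rw [← ENNReal.ofReal_toReal (hfin _ isCompact_Icc).ne]
      apply ENNReal.ofReal_le_ofReal
      rcases le_total s₀ s with hss | hss
      · obtain ⟨h1, h2⟩ := hs₀ s hss
        rw [div_lt_iff₀ h2] at h1
        calc _ ≤ exp (log (μ (Icc 0 (s ^ α))).toReal) := le_exp_log _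
          _ ≤ 1 * exp (b * s) := by
              rw [one_mul]
              gcongr
          _ ≤ _ := by
              gcongr
              exact le_max_left _ _
      · calc (μ (Icc 0 (s ^ α))).toReal ≤ (μ (Icc 0 (s₀ ^ α))).toReal := by
              refine ENNReal.toReal_mono (hfin _ isCompact_Icc).ne (measure_mono ?_)
              gcongr
          _ ≤ K := le_max_right _ _
          _ ≤ _ := le_mul_of_one_le_right (by positivity) hexp
    have hint := integrable_exp_neg_mul_rpow hsupp hα0 (by linarith) hbb' hN
    set J := ∫ x, exp (-(b' * x ^ (1 / α))) ∂μ with hJ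
    have hJ0 : 0 < J := integral_exp_pos hint
    have hlim : Tendsto (fun s : ℝ => (α - 1) * (b' / α) ^ (α / (α - 1)) + log J / s) atTop
        (nhds ((α - 1) * (b' / α) ^ (α / (α - 1)) + 0)) :=
      (tendsto_id.const_div_atTop (log J)).const_add _
    rw [add_zero] at hlim
    filter_upwards [hlim.eventually_lt_const hb'c, eventually_gt_atTop 0] with s hs hs0
    refine lt_of_le_of_lt ?_ hs
    have hsa : 0 < s ^ (α - 1) := rpow_pos_of_pos hs0 _
    have hae : ∀ᵐ x ∂μ, 0 ≤ x := by
      rw [ae_iff]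
      simpa [Iio] using hsupp
    have hle := integral_mono_ae (hM _ hsa)
      (hint.const_mul (exp ((α - 1) * (b' / α) ^ (α / (α - 1)) * s))) (by
        filter_upwards [hae] with x hx
        rw [← exp_add]
        apply exp_le_exp.2
        have := mul_rpow_le_add_div hα (hB.trans hb') hs0 hx
        rw [neg_div]
        linarith)
    rw [integral_const_mul] at hle
    have hlog := log_le_log (hMpos _ hsa) hle
    rw [log_mul (exp_pos _).ne' hJ0.ne', log_exp] at hlog
    rw [div_le_iff₀ hs0, add_mul, div_mul_cancel₀ _ hs0.ne']
    exact hlog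

/-- The Tauberian half, in the variable `s` with `x = s ^ α` and `l = s ^ (α - 1)`. -/
lemma tendsto_log_measure_of_tendsto_log_laplace {μ : Measure ℝ} {α B : ℝ} (hα : 1 < α)
    (hB : 0 < B) (hsupp : μ (Iio 0) = 0) (hfin : ∀ K : Set ℝ, IsCompact K → μ K < ⊤)
    (hμ0 : μ ≠ 0) (hM : ∀ l > 0, Integrable (fun x => exp (-x / l)) μ)
    (h : Tendsto (fun s => log (∫ x, exp (-x / s ^ (α - 1)) ∂μ) / s) atTop
      (nhds ((α - 1) * (B / α) ^ (α / (α - 1))))) :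
    Tendsto (fun s => log (μ (Icc 0 (s ^ α))).toReal / s) atTop (nhds B) := by
  have hα0 : 0 < α := by linarith
  have hα1 : 0 < α - 1 := by linarith
  have : NeZero μ := ⟨hμ0⟩
  have hMpos : ∀ l > 0, 0 < ∫ x, exp (-x / l) ∂μ := fun l hl => integral_exp_pos (hM l hl)
  set t₀ := B / α with ht₀
  have ht₀0 : 0 < t₀ := by positivity
  set C := (α - 1) * t₀ ^ (α / (α - 1)) with hC
  set Λ : ℝ → ℝ := fun t => C * t ^ (-(1 / (α - 1))) with hΛ
  have hlim : ∀ t > 0, Tendsto (fun s => log (∫ x, exp (-x / (s ^ (α - 1) / t)) ∂μ) / s) atTop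
      (nhds (Λ t)) := fun t ht =>
    tendsto_comp_rpow_div (f := fun l => log (∫ x, exp (-x / l) ∂μ)) hα1 ht h
  have hΛ₀ : Λ t₀ + t₀ = B := by
    simp only [hΛ, hC]
    rw [mul_assoc, ← rpow_add ht₀0]
    have : α / (α - 1) + -(1 / (α - 1)) = 1 := by field_simp; ring
    rw [this, rpow_one, ht₀]
    field_simp
    ring
  have hderiv : ∀ t > 0, HasDerivAt Λ (-(t₀ / t) ^ (α / (α - 1))) t := by
    intro t ht
    have := (hasDerivAt_rpow_const (p := -(1 / (α - 1))) (Or.inl ht.ne')).const_mul C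
    refine this.congr_deriv ?_
    have e : -(1 / (α - 1)) - 1 = -(α / (α - 1)) := by field_simp; ring
    rw [e, div_rpow ht₀0.le ht.le, rpow_neg ht.le, hC]
    have := rpow_pos_of_pos ht (α / (α - 1))
    field_simp
  have hscale : ∀ s : ℝ, 0 < s → s ^ α = s * s ^ (α - 1) := fun s hs => by
    rw [← rpow_one_add' hs.le (by linarith)]
    congr 1
    ring
  have hlower : ∀ c < B, ∀ᶠ s in atTop, c < log (μ (Icc 0 (s ^ α))).toReal / s := by
    intro c hc
    set ζ : ℝ → ℝ := fun t => (t₀ / t) ^ (α / (α - 1) + 1) with hζ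
    obtain ⟨t, htc, htt₀⟩ : ∃ t, c < ζ t * t + Λ t ∧ t₀ < t := by
      have hcont : ContinuousAt (fun t => ζ t * t + Λ t) t₀ := by
        refine ContinuousAt.add (ContinuousAt.mul ?_ continuousAt_id)
          (hderiv t₀ ht₀0).continuousAt
        refine ContinuousAt.rpow_const (continuousAt_const.div continuousAt_id ht₀0.ne')
          (Or.inr (by positivity))
      have hval : c < ζ t₀ * t₀ + Λ t₀ := by
        simp only [hζ]
        rw [div_self ht₀0.ne', one_rpow]
        linarith
      have hev : ∀ᶠ t in nhdsWithin t₀ (Ioi t₀), c < ζ t * t + Λ t :=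
        (hcont.eventually_const_lt hval).filter_mono nhdsWithin_le_nhds
      exact (hev.and self_mem_nhdsWithin).exists
    have ht : 0 < t := ht₀0.trans htt₀
    have hq0 : 0 < t₀ / t := by positivity
    have hq1 : t₀ / t < 1 := (div_lt_one ht).2 htt₀
    set z := ζ t with hz
    have hz1 : z < (t₀ / t) ^ (α / (α - 1)) :=
      rpow_lt_rpow_of_exponent_gt hq0 hq1 (by linarith)
    have hz2 : (t₀ / t) ^ (α / (α - 1)) < 1 := rpow_lt_one hq0.le hq1 (by positivity)
    obtain ⟨t₁, ht₁0, ht₁, hg₁⟩ := exists_lt_of_hasDerivAt_pos ht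
      ((hderiv t ht).add (hasDerivAt_id t)) (by linarith)
    obtain ⟨t₂, ht₂, hg₂⟩ := exists_gt_of_hasDerivAt_neg
      ((hderiv t ht).add ((hasDerivAt_id t).const_mul z)) (by linarith)
    simp only [Pi.add_apply, id] at hg₁ hg₂
    have ht₂0 : 0 < t₂ := ht.trans ht₂
    obtain ⟨η, hη, hη₁, hη₂, hηc⟩ : ∃ η > 0, Λ t₁ + t₁ + 3 * η ≤ Λ t + t ∧
        Λ t₂ + z * t₂ + 3 * η ≤ Λ t + z * t ∧ c + 3 * η ≤ z * t + Λ t := by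
      refine ⟨min (min (Λ t + t - (Λ t₁ + t₁)) (Λ t + z * t - (Λ t₂ + z * t₂)))
        (z * t + Λ t - c) / 3, ?_, ?_, ?_, ?_⟩
      · have : 0 < min (min (Λ t + t - (Λ t₁ + t₁)) (Λ t + z * t - (Λ t₂ + z * t₂)))
          (z * t + Λ t - c) := by
          refine lt_min (lt_min ?_ ?_) ?_ <;> linarith
        positivity
      · linarith [(min_le_left (min (Λ t + t - (Λ t₁ + t₁)) (Λ t + z * t - (Λ t₂ + z * t₂)))
          (z * t + Λ t - c)).trans (min_le_left _ _)]
      · linarith [(min_le_left (min (Λ t + t - (Λ t₁ + t₁)) (Λ t + z * t - (Λ t₂ + z * t₂)))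
          (z * t + Λ t - c)).trans (min_le_right _ _)]
      · linarith [min_le_right (min (Λ t + t - (Λ t₁ + t₁)) (Λ t + z * t - (Λ t₂ + z * t₂)))
          (z * t + Λ t - c)]
    filter_upwards [eventually_gt_atTop 0, eventually_ge_atTop (log 4 / η),
      (hlim t ht).eventually_const_lt (show Λ t - η < Λ t by linarith),
      (hlim t₁ ht₁0).eventually_lt_const (show Λ t₁ < Λ t₁ + η by linarith),
      (hlim t₂ ht₂0).eventually_lt_const (show Λ t₂ < Λ t₂ + η by linarith)]
      with s hs hs4 hm hm₁ hm₂
    have hsa : 0 < s ^ (α - 1) := rpow_pos_of_pos hs _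
    have hl : ∀ t > 0, 0 < s ^ (α - 1) / t := fun t ht => by positivity
    have hsplit := integral_exp_le_of_split hsupp (l := s ^ (α - 1) / t)
      (l₁ := s ^ (α - 1) / t₁) (l₂ := s ^ (α - 1) / t₂) (X := s ^ α) (Z := z * s ^ α)
      (by rw [one_div_div, one_div_div]; gcongr) (by rw [one_div_div, one_div_div]; gcongr)
      (hfin _ isCompact_Icc) (hl t ht) (hM _ (hl t ht)) (hM _ (hl _ ht₁0)) (hM _ (hl _ ht₂0))
    set m := ∫ x, exp (-x / (s ^ (α - 1) / t)) ∂μ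
    set m₁ := ∫ x, exp (-x / (s ^ (α - 1) / t₁)) ∂μ
    set m₂ := ∫ x, exp (-x / (s ^ (α - 1) / t₂)) ∂μ
    set N := (μ (Icc 0 (s ^ α))).toReal
    have e₁ : -(s ^ α * (1 / (s ^ (α - 1) / t) - 1 / (s ^ (α - 1) / t₁))) = (t₁ - t) * s := by
      rw [hscale s hs]
      field_simp
      ring
    have e₂ : z * s ^ α * (1 / (s ^ (α - 1) / t₂) - 1 / (s ^ (α - 1) / t)) = z * (t₂ - t) * s := by
      rw [hscale s hs]
      field_simp
    have e₃ : -(z * s ^ α) / (s ^ (α - 1) / t) = -(z * t * s) := by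
      rw [hscale s hs]
      field_simp
    rw [e₁, e₂, e₃] at hsplit
    rw [lt_div_iff₀ hs] at hm
    rw [div_lt_iff₀ hs] at hm₁ hm₂
    set E := exp ((Λ t - η) * s) with hE
    have hEpos : 0 < E := exp_pos _
    have hmE : E ≤ m := (exp_le_exp.2 hm.le).trans_eq (exp_log (hMpos _ (hl t ht)))
    have hsη : exp (-(η * s)) ≤ 1 / 4 := by
      rw [div_le_iff₀ hη] at hs4
      calc exp (-(η * s)) ≤ exp (-log 4) := by
            gcongr
            linarith
        _ = 1 / 4 := by
            rw [exp_neg, exp_log (by norm_num), one_div]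
    have hsmall : exp ((Λ t - 2 * η) * s) ≤ E / 4 := by
      have : (Λ t - 2 * η) * s = (Λ t - η) * s + -(η * s) := by ring
      rw [this, exp_add]
      linarith [mul_le_mul_of_nonneg_left hsη hEpos.le]
    have b₁ : exp ((t₁ - t) * s) * m₁ ≤ E / 4 := by
      refine le_trans ?_ hsmall
      calc _ ≤ exp ((t₁ - t) * s) * exp ((Λ t₁ + η) * s) := by
            gcongr
            exact (le_exp_log _).trans (exp_le_exp.2 hm₁.le)
        _ ≤ _ := by
            rw [← exp_add, ← add_mul]
            gcongr
            linarith
    have b₂ : exp (z * (t₂ - t) * s) * m₂ ≤ E / 4 := by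
      refine le_trans ?_ hsmall
      calc _ ≤ exp (z * (t₂ - t) * s) * exp ((Λ t₂ + η) * s) := by
            gcongr
            exact (le_exp_log _).trans (exp_le_exp.2 hm₂.le)
        _ ≤ _ := by
            rw [← exp_add, ← add_mul]
            gcongr
            linarith
    have hN : exp ((Λ t - 2 * η) * s) ≤ exp (-(z * t * s)) * N := by linarith
    have hN' : exp ((z * t + Λ t - 2 * η) * s) ≤ N := by
      have := mul_le_mul_of_nonneg_left hN (exp_pos (z * t * s)).le
      rw [← mul_assoc, ← exp_add, ← exp_add, add_neg_cancel, exp_zero, one_mul] at this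
      refine le_trans (le_of_eq ?_) this
      congr 1
      ring
    have hlog := log_le_log (exp_pos _) hN'
    rw [log_exp] at hlog
    rw [lt_div_iff₀ hs]
    refine lt_of_lt_of_le ?_ hlog
    gcongr
    linarith
  refine tendsto_order.2 ⟨hlower, fun c hc => ?_⟩
  filter_upwards [hlower 0 hB, eventually_gt_atTop 0,
    (hlim t₀ ht₀0).eventually_lt_const (show Λ t₀ < c - t₀ by linarith)] with s hpos hs hm
  have hsa : 0 < s ^ (α - 1) := rpow_pos_of_pos hs _
  have hl : 0 < s ^ (α - 1) / t₀ := by positivity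
  have hNpos : 0 < (μ (Icc 0 (s ^ α))).toReal := by
    refine lt_of_le_of_ne ENNReal.toReal_nonneg fun h0 => ?_
    rw [← h0] at hpos
    simp at hpos
  have hlog := log_le_log (by positivity)
    (exp_mul_measure_Icc_le_integral hl (s ^ α) (hfin _ isCompact_Icc) (hM _ hl))
  rw [log_mul (exp_pos _).ne' hNpos.ne', log_exp] at hlog
  have e : -s ^ α / (s ^ (α - 1) / t₀) = -(t₀ * s) := by
    rw [hscale s hs]
    field_simp
  rw [e] at hlog
  rw [div_lt_iff₀ hs] at hm ⊢
  linarith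

/-- Kohlbecker's Tauberian theorem. -/
theorem kohlbecker (μ : Measure ℝ) (α B : ℝ) (hα : 1 < α) (hB : 0 < B)
    (hμ0 : μ ≠ 0) (hsupp : μ (Iio 0) = 0)
    (hfin : ∀ K : Set ℝ, IsCompact K → μ K < ⊤)
    (hM : ∀ l > 0, Integrable (fun x => Real.exp (-x / l)) μ) :
    (Tendsto (fun x => Real.log (μ (Icc 0 x)).toReal / (B * x ^ (1 / α))) atTop (nhds 1) ↔
     Tendsto (fun l => Real.log (∫ x, Real.exp (-x / l) ∂μ) /
       ((α - 1) * (B / α) ^ (α / (α - 1)) * l ^ (1 / (α - 1)))) atTop (nhds 1)) := by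
  have hα1 : 0 < α - 1 := by linarith
  have hC : 0 < (α - 1) * (B / α) ^ (α / (α - 1)) :=
    mul_pos hα1 (rpow_pos_of_pos (div_pos hB (by linarith)) _)
  rw [tendsto_div_mul_rpow_iff (fun x => log (μ (Icc 0 x)).toReal) (by linarith) hB,
    tendsto_div_mul_rpow_iff (fun l => log (∫ x, exp (-x / l) ∂μ)) hα1 hC]
  exact ⟨tendsto_log_laplace_of_tendsto_log_measure hα hB hsupp hfin hμ0 hM,
    tendsto_log_measure_of_tendsto_log_laplace hα hB hsupp hfin hμ0 hM⟩
end

section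
/- (Kasahara's Tauberian theorem.) log(μ(x,∞)) / (−B x^{1/α}) → 1 as x → ∞ if and only if log(M(λ)) / ((1−α)(α/B)^{α/(1−α)} λ^{1/(1−α)}) → 1 as λ → ∞. -/
open Real Filter MeasureTheory Set

namespace Kasahara

/-- A measure on `(0, ∞)` with an exponential moment is finite. -/
lemma isFiniteMeasure_of_integrable_exp {μ : Measure ℝ} {l : ℝ} (hl : 0 < l)
    (hsupp : μ (Iic 0) = 0) (hM : Integrable (fun x => Real.exp (l * x)) μ) :
    IsFiniteMeasure μ := by
  constructor
  have h1 : μ {x | (1 : ℝ) ≤ ‖Real.exp (l * x)‖} < ⊤ := hM.measure_norm_ge_lt_top one_pos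
  have h2 : (univ : Set ℝ) ⊆ Iic 0 ∪ {x | (1 : ℝ) ≤ ‖Real.exp (l * x)‖} := by
    intro x _
    rcases le_or_gt x 0 with h | h
    · exact Or.inl h
    · right
      simp only [mem_ofPred_eq, Real.norm_eq_abs, Real.abs_exp]
      exact Real.one_le_exp (by positivity)
  calc μ univ ≤ μ (Iic 0 ∪ {x | (1 : ℝ) ≤ ‖Real.exp (l * x)‖}) := measure_mono h2
    _ ≤ μ (Iic 0) + μ {x | (1 : ℝ) ≤ ‖Real.exp (l * x)‖} := measure_union_le _ _
    _ < ⊤ := by rw [hsupp, zero_add]; exact h1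

/-- Chernoff's bound. -/
lemma exp_mul_tail_le {μ : Measure ℝ} [IsFiniteMeasure μ] {l x : ℝ} (hl : 0 < l)
    (hM : Integrable (fun x => Real.exp (l * x)) μ) :
    Real.exp (l * x) * μ.real (Ioi x) ≤ ∫ u, Real.exp (l * u) ∂μ := by
  calc Real.exp (l * x) * μ.real (Ioi x) = ∫ _ in Ioi x, Real.exp (l * x) ∂μ := by
        simp [mul_comm]
    _ ≤ ∫ u in Ioi x, Real.exp (l * u) ∂μ := by
        refine setIntegral_mono_on (integrable_const _).integrableOn hM.integrableOn
          measurableSet_Ioi fun u hu => ?_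
        have : x < u := hu
        gcongr
    _ ≤ ∫ u, Real.exp (l * u) ∂μ :=
        setIntegral_le_integral hM (ae_of_all _ fun u => (Real.exp_pos _).le)

/-- Splitting an exponential moment at two points `x` and `z`, the outer pieces being controlled by
moments of slightly smaller and slightly larger order. -/
lemma integral_exp_le_tilt {μ : Measure ℝ} [IsFiniteMeasure μ] {l h x z : ℝ} (hh : 0 < h)
    (hl : h < l) (hM : ∀ l > 0, Integrable (fun x => Real.exp (l * x)) μ) :
    ∫ u, Real.exp (l * u) ∂μ ≤ Real.exp (h * x) * ∫ u, Real.exp ((l - h) * u) ∂μ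
      + Real.exp (-(h * z)) * (∫ u, Real.exp ((l + h) * u) ∂μ)
      + Real.exp (l * z) * μ.real (Ioi x) := by
  have hl0 : 0 < l := hh.trans hl
  have i1 := (hM (l - h) (by linarith)).const_mul (Real.exp (h * x))
  have i2 := (hM (l + h) (by linarith)).const_mul (Real.exp (-(h * z)))
  have i3 : Integrable ((Ioi x).indicator fun _ => Real.exp (l * z)) μ :=
    (integrable_const _).indicator measurableSet_Ioi
  have e3 : ∫ u, (Ioi x).indicator (fun _ => Real.exp (l * z)) u ∂μ
      = Real.exp (l * z) * μ.real (Ioi x) := by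
    rw [integral_indicator measurableSet_Ioi]; simp [mul_comm]
  rw [← e3, ← integral_const_mul, ← integral_const_mul, ← integral_add i1 i2]
  refine le_trans ?_ (integral_add (i1.add i2) i3).le
  refine integral_mono (hM l hl0) ((i1.add i2).add i3) fun u => ?_
  have p1 : 0 < Real.exp (h * x) * Real.exp ((l - h) * u) := by positivity
  have p2 : 0 < Real.exp (-(h * z)) * Real.exp ((l + h) * u) := by positivity
  have p3 : 0 ≤ (Ioi x).indicator (fun _ => Real.exp (l * z)) u :=
    indicator_nonneg (fun _ _ => (Real.exp_pos _).le) u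
  simp only [Pi.add_apply]
  rcases le_or_gt u x with hu | hu
  · have : Real.exp (l * u) ≤ Real.exp (h * x) * Real.exp ((l - h) * u) := by
      rw [← Real.exp_add]; apply Real.exp_le_exp.2; nlinarith
    linarith
  · rcases le_or_gt u z with hz | hz
    · have : Real.exp (l * u) ≤ (Ioi x).indicator (fun _ => Real.exp (l * z)) u := by
        rw [indicator_of_mem (mem_Ioi.2 hu)]
        gcongr
      linarith
    · have : Real.exp (l * u) ≤ Real.exp (-(h * z)) * Real.exp ((l + h) * u) := by
        rw [← Real.exp_add]; apply Real.exp_le_exp.2; nlinarith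
      linarith

/-- A function whose tails decay like a power with exponent less than `-1` is integrable. -/
lemma integrable_of_tail_le_rpow {μ : Measure ℝ} [IsFiniteMeasure μ] {f : ℝ → ℝ} {r T : ℝ}
    (hf : Measurable f) (hf0 : ∀ x, 0 ≤ f x) (hr : r < -1) (hT : 0 < T)
    (h : ∀ t > T, μ {x | t < f x} ≤ ENNReal.ofReal (t ^ r)) : Integrable f μ := by
  refine ⟨hf.aestronglyMeasurable, ?_⟩
  rw [hasFiniteIntegral_iff_ofReal (ae_of_all _ hf0),
    lintegral_eq_lintegral_meas_lt μ (ae_of_all _ hf0) hf.aemeasurable,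
    ← Ioc_union_Ioi_eq_Ioi hT.le]
  refine (lintegral_union_le _ _ _).trans_lt (ENNReal.add_lt_top.2 ⟨?_, ?_⟩)
  · calc ∫⁻ t in Ioc 0 T, μ {x | t < f x} ≤ ∫⁻ _ in Ioc 0 T, μ univ :=
          lintegral_mono fun t => measure_mono (subset_univ _)
      _ < ⊤ := by
          rw [setLIntegral_const]
          exact ENNReal.mul_lt_top (measure_lt_top _ _) (by simp)
  · calc ∫⁻ t in Ioi T, μ {x | t < f x} ≤ ∫⁻ t in Ioi T, ENNReal.ofReal (t ^ r) :=
          setLIntegral_mono' measurableSet_Ioi h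
      _ < ⊤ := (integrableOn_Ioi_rpow_of_lt hr hT).lintegral_lt_top

/-- A tail bound `exp (-b x ^ p)` gives finite moments `exp (b' x ^ p)` for `b' < b`. -/
lemma integrable_exp_mul_rpow {μ : Measure ℝ} [IsFiniteMeasure μ] {p b b' : ℝ} (hp : 0 < p)
    (hb' : 0 < b') (hb : b' < b)
    (h : ∀ᶠ x in atTop, μ.real (Ioi x) ≤ Real.exp (-b * x ^ p)) :
    Integrable (fun x => Real.exp (b' * (max x 0) ^ p)) μ := by
  obtain ⟨X, hX⟩ := eventually_atTop.1 h
  set Y := max X 0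
  have hY0 : 0 ≤ Y := le_max_right _ _
  refine integrable_of_tail_le_rpow (r := -(b / b')) (T := Real.exp (b' * Y ^ p)) ?_
    (fun x => (Real.exp_pos _).le) ?_ (Real.exp_pos _) fun t ht => ?_
  · fun_prop
  · have := (one_lt_div hb').2 hb
    linarith
  · have ht0 : 0 < t := (Real.exp_pos _).trans ht
    have hlog : b' * Y ^ p < Real.log t := (Real.lt_log_iff_exp_lt ht0).2 ht
    have hYp : 0 ≤ Y ^ p := by positivity
    have hlog0 : 0 ≤ Real.log t / b' := by
      have : 0 ≤ b' * Y ^ p := by positivity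
      have := this.trans hlog.le
      positivity
    set x := (Real.log t / b') ^ p⁻¹ with hx
    have hxp : x ^ p = Real.log t / b' := Real.rpow_inv_rpow hlog0 hp.ne'
    have hx0 : 0 ≤ x := by positivity
    have hYx : Y ≤ x := by
      refine (Real.rpow_le_rpow_iff hY0 hx0 hp).1 ?_
      rw [hxp, le_div_iff₀ hb']
      linarith
    have hsub : {u | t < Real.exp (b' * (max u 0) ^ p)} ⊆ Ioi x := by
      intro u hu
      have h1 : Real.log t < b' * (max u 0) ^ p := (Real.log_lt_iff_lt_exp ht0).2 hu
      have h2 : x ^ p < (max u 0) ^ p := by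
        rw [hxp, div_lt_iff₀ hb']
        linarith
      have h3 := (Real.rpow_lt_rpow_iff hx0 (le_max_right _ _) hp).1 h2
      rcases lt_max_iff.1 h3 with h | h
      · exact h
      · linarith
    calc μ {u | t < Real.exp (b' * (max u 0) ^ p)} ≤ μ (Ioi x) := measure_mono hsub
      _ = ENNReal.ofReal (μ.real (Ioi x)) := by simp
      _ ≤ ENNReal.ofReal (t ^ (-(b / b'))) := by
          refine ENNReal.ofReal_le_ofReal ((hX x ((le_max_left _ _).trans hYx)).trans_eq ?_)
          rw [hxp, Real.rpow_def_of_pos ht0]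
          congr 1
          ring

/-- The Legendre transform of `b x ^ (1 / α)`. -/
lemma mul_sub_rpow_le {α b l x : ℝ} (hα0 : 0 < α) (hα1 : α < 1) (hb : 0 < b) (hl : 0 < l)
    (hx : 0 ≤ x) :
    l * x ≤ (1 - α) * (α / b) ^ (α / (1 - α)) * l ^ (1 / (1 - α)) + b * x ^ (1 / α) := by
  have h1α : 0 < 1 - α := by linarith
  have hpq : (1 / α).HolderConjugate (1 / (1 - α)) := by
    rw [Real.holderConjugate_iff]
    exact ⟨(one_lt_div hα0).2 hα1, by simp⟩
  have hc : 0 < (b / α) ^ α := by positivity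
  have := Real.young_inequality_of_nonneg (a := (b / α) ^ α * x) (b := l / (b / α) ^ α)
    (by positivity) (by positivity) hpq
  have e1 : ((b / α) ^ α * x) ^ (1 / α) / (1 / α) = b * x ^ (1 / α) := by
    rw [Real.mul_rpow hc.le hx, ← Real.rpow_mul (by positivity), mul_one_div_cancel hα0.ne',
      Real.rpow_one]
    field_simp
  have e2 : (l / (b / α) ^ α) ^ (1 / (1 - α)) / (1 / (1 - α))
      = (1 - α) * (α / b) ^ (α / (1 - α)) * l ^ (1 / (1 - α)) := by
    rw [Real.div_rpow hl.le hc.le, ← Real.rpow_mul (by positivity), ← inv_div b α,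
      Real.inv_rpow (by positivity), mul_one_div]
    field_simp
  have e3 : (b / α) ^ α * x * (l / (b / α) ^ α) = l * x := by
    field_simp
  rw [e1, e2, e3] at this
  linarith

/-- A tail bound gives a bound for the exponential moments. -/
lemma integral_exp_le_of_tail_le {μ : Measure ℝ} [IsFiniteMeasure μ] {α b b' : ℝ}
    (hα0 : 0 < α) (hα1 : α < 1) (hb' : 0 < b') (hb : b' < b)
    (hM : ∀ l > 0, Integrable (fun x => Real.exp (l * x)) μ)
    (h : ∀ᶠ x in atTop, μ.real (Ioi x) ≤ Real.exp (-b * x ^ (1 / α))) :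
    ∃ K > 0, ∀ l > 0, ∫ u, Real.exp (l * u) ∂μ ≤
      K * Real.exp ((1 - α) * (α / b') ^ (α / (1 - α)) * l ^ (1 / (1 - α))) := by
  have hI := integrable_exp_mul_rpow (by positivity) hb' hb h
  have hI0 : 0 ≤ ∫ x, Real.exp (b' * (max x 0) ^ (1 / α)) ∂μ :=
    integral_nonneg fun x => (Real.exp_pos _).le
  refine ⟨(∫ x, Real.exp (b' * (max x 0) ^ (1 / α)) ∂μ) + 1, by linarith, fun l hl => ?_⟩
  calc ∫ u, Real.exp (l * u) ∂μ
      ≤ ∫ x, Real.exp (b' * (max x 0) ^ (1 / α)) *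
        Real.exp ((1 - α) * (α / b') ^ (α / (1 - α)) * l ^ (1 / (1 - α))) ∂μ := by
        refine integral_mono (hM l hl) (hI.mul_const _) fun x => ?_
        simp only
        rw [← Real.exp_add]
        apply Real.exp_le_exp.2
        have h1 := mul_sub_rpow_le hα0 hα1 hb' hl (le_max_right x 0)
        have h2 := mul_le_mul_of_nonneg_left (le_max_left x 0) hl.le
        linarith
    _ = (∫ x, Real.exp (b' * (max x 0) ^ (1 / α)) ∂μ) *
        Real.exp ((1 - α) * (α / b') ^ (α / (1 - α)) * l ^ (1 / (1 - α))) := by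
        rw [integral_mul_const]
    _ ≤ _ := by gcongr; linarith

/-- Convergence of a quotient to one, restated as convergence to a constant. -/
lemma tendsto_div_const_mul_iff {f g : ℝ → ℝ} {c : ℝ} (hc : c ≠ 0) :
    Tendsto (fun x => f x / (c * g x)) atTop (nhds 1) ↔
      Tendsto (fun x => f x / g x) atTop (nhds c) := by
  constructor
  · intro h
    have := h.const_mul c
    rw [mul_one] at this
    refine this.congr fun x => ?_
    field_simp
  · intro h
    have := h.const_mul c⁻¹
    rw [inv_mul_cancel₀ hc] at this
    refine this.congr fun x => ?_
    field_simp

lemma mul_rpow_rpow_conj {α s x : ℝ} (hα0 : 0 < α) (hα1 : α < 1) (hs : 0 ≤ s) (hx : 0 ≤ x) :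
    (s * x ^ (1 / α - 1)) ^ (1 / (1 - α)) = s ^ (1 / (1 - α)) * x ^ (1 / α) := by
  have h1α : 0 < 1 - α := by linarith
  rw [Real.mul_rpow hs (by positivity), ← Real.rpow_mul hx]
  congr 2
  field_simp

/-- The value of the Legendre transform at the slope belonging to the point `1`. -/
lemma legendre_value {α B : ℝ} (hα0 : 0 < α) (hα1 : α < 1) (hB : 0 < B) :
    (1 - α) * (α / B) ^ (α / (1 - α)) * (B / α) ^ (1 / (1 - α)) = B / α - B := by
  have h1α : 0 < 1 - α := by linarith
  have h : 1 / (1 - α) = 1 + α / (1 - α) := by field_simp; ring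
  have hb : 0 < B / α := by positivity
  have h2 : 0 < (B / α) ^ (α / (1 - α)) := by positivity
  rw [h, Real.rpow_add hb, Real.rpow_one, ← inv_div B α, Real.inv_rpow hb.le]
  field_simp

/-- The derivative of the Legendre transform. -/
lemma legendre_hasDerivAt {α B s : ℝ} (hα0 : 0 < α) (hα1 : α < 1) (hB : 0 < B) (hs : 0 < s) :
    HasDerivAt (fun s => (1 - α) * (α / B) ^ (α / (1 - α)) * s ^ (1 / (1 - α)))
      ((α / B * s) ^ (α / (1 - α))) s := by
  have h1α : 0 < 1 - α := by linarith
  have := (Real.hasDerivAt_rpow_const (x := s) (p := 1 / (1 - α)) (Or.inl hs.ne')).const_mul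
    ((1 - α) * (α / B) ^ (α / (1 - α)))
  refine this.congr_deriv ?_
  have h : 1 / (1 - α) - 1 = α / (1 - α) := by field_simp; ring
  rw [h, Real.mul_rpow (by positivity) hs.le]
  field_simp

lemma eventually_le_of_tendsto_div_neg {f g : ℝ → ℝ} {c : ℝ} (a : ℝ) (hc : c < 0)
    (hg : Tendsto g atTop atTop) (h : Tendsto (fun x => f x / g x) atTop (nhds c)) :
    ∀ᶠ x in atTop, f x ≤ a := by
  filter_upwards [(h.neg_mul_atTop hc hg).eventually_le_atBot a, hg.eventually_gt_atTop 0]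
    with x hx hgx
  rwa [div_mul_cancel₀ _ hgx.ne'] at hx

section

variable {μ : Measure ℝ} {α B : ℝ}

/-- Chernoff's bound in logarithmic and rescaled form. -/
lemma add_log_tail_div_le [IsFiniteMeasure μ] {s x : ℝ} (hs : 0 < s) (hx : 0 < x)
    (hM : ∀ l > 0, Integrable (fun x => Real.exp (l * x)) μ) (hpos : 0 < μ.real (Ioi x)) :
    s + Real.log (μ.real (Ioi x)) / x ^ (1 / α) ≤
      Real.log (∫ u, Real.exp (s * x ^ (1 / α - 1) * u) ∂μ) / x ^ (1 / α) := by
  have hl : 0 < s * x ^ (1 / α - 1) := by positivity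
  have h := Real.log_le_log (by positivity) (exp_mul_tail_le (x := x) hl (hM _ hl))
  rw [Real.log_mul (by positivity) hpos.ne', Real.log_exp, mul_assoc,
    ← Real.rpow_add_one hx.ne', sub_add_cancel] at h
  have hxp : 0 < x ^ (1 / α) := by positivity
  rw [le_div_iff₀ hxp, add_mul, div_mul_cancel₀ _ hxp.ne']
  exact h

lemma tendsto_log_moment_div [IsFiniteMeasure μ] (hα0 : 0 < α) (hα1 : α < 1) (hB : 0 < B)
    (hM : ∀ l > 0, Integrable (fun x => Real.exp (l * x)) μ)
    (hpos : ∀ x > 0, 0 < μ.real (Ioi x)) (hM0 : ∀ l > 0, 0 < ∫ u, Real.exp (l * u) ∂μ)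
    (h : Tendsto (fun x => Real.log (μ.real (Ioi x)) / x ^ (1 / α)) atTop (nhds (-B))) :
    Tendsto (fun l => Real.log (∫ x, Real.exp (l * x) ∂μ) / l ^ (1 / (1 - α))) atTop
      (nhds ((1 - α) * (α / B) ^ (α / (1 - α)))) := by
  have h1α : 0 < 1 - α := by linarith
  have hs0 : 0 < B / α := by positivity
  have hq : (0 : ℝ) < 1 / (1 - α) := by positivity
  refine tendsto_order.2 ⟨fun a ha => ?_, fun a ha => ?_⟩
  · have hlim := h.const_add (B / α)
    rw [← sub_eq_add_neg, ← legendre_value hα0 hα1 hB] at hlim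
    have hsq : 0 < (B / α) ^ (1 / (1 - α)) := by positivity
    have hev := hlim.eventually_const_lt (mul_lt_mul_of_pos_right ha hsq)
    have hr : 0 < α / (1 - α) := by positivity
    have hx : Tendsto (fun l : ℝ => (l / (B / α)) ^ (α / (1 - α))) atTop atTop :=
      (tendsto_rpow_atTop hr).comp (tendsto_id.atTop_div_const hs0)
    filter_upwards [hx.eventually hev, eventually_gt_atTop 0] with l hl hl0
    set x := (l / (B / α)) ^ (α / (1 - α)) with hxdef
    have hx0 : 0 < x := by positivity
    have hlx : B / α * x ^ (1 / α - 1) = l := by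
      rw [hxdef, ← Real.rpow_mul (by positivity)]
      have : α / (1 - α) * (1 / α - 1) = 1 := by field_simp
      rw [this, Real.rpow_one]
      field_simp
    have hb := hl.trans_le (add_log_tail_div_le (α := α) hs0 hx0 hM (hpos x hx0))
    have hlq := mul_rpow_rpow_conj hα0 hα1 hs0.le hx0.le
    rw [hlx] at hb hlq
    have hxp : 0 < x ^ (1 / α) := by positivity
    rw [lt_div_iff₀ hxp] at hb
    rw [lt_div_iff₀ (by positivity), hlq]
    linarith
  · have hcont : ContinuousAt (fun b : ℝ => (1 - α) * (α / b) ^ (α / (1 - α))) B := by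
      refine continuousAt_const.mul (ContinuousAt.rpow_const ?_ (Or.inl (by positivity)))
      exact continuousAt_const.div continuousAt_id hB.ne'
    have hev : ∀ᶠ b in nhdsWithin B (Iio B),
        (1 - α) * (α / b) ^ (α / (1 - α)) < a ∧ 0 < b ∧ b < B := by
      filter_upwards [(hcont.eventually_lt_const ha).filter_mono nhdsWithin_le_nhds,
        (eventually_gt_nhds hB).filter_mono nhdsWithin_le_nhds, self_mem_nhdsWithin]
        with b h1 h2 h3 using ⟨h1, h2, h3⟩
    obtain ⟨b', hb'a, hb'0, hb'B⟩ := hev.exists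
    obtain ⟨b, hb1, hb2⟩ := exists_between hb'B
    have htail : ∀ᶠ x in atTop, μ.real (Ioi x) ≤ Real.exp (-b * x ^ (1 / α)) := by
      filter_upwards [h.eventually_lt_const (neg_lt_neg hb2), eventually_gt_atTop 0]
        with x hx hx0
      rw [div_lt_iff₀ (by positivity)] at hx
      exact ((Real.log_lt_iff_lt_exp (hpos x hx0)).1 hx).le
    obtain ⟨K, hK0, hK⟩ := integral_exp_le_of_tail_le hα0 hα1 hb'0 hb1 hM htail
    have hlim : Tendsto (fun l : ℝ => Real.log K / l ^ (1 / (1 - α))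
        + (1 - α) * (α / b') ^ (α / (1 - α))) atTop
        (nhds (0 + (1 - α) * (α / b') ^ (α / (1 - α)))) :=
      ((tendsto_rpow_atTop hq).const_div_atTop _).add_const _
    rw [zero_add] at hlim
    filter_upwards [hlim.eventually_lt_const hb'a, eventually_gt_atTop 0] with l hl hl0
    refine lt_of_le_of_lt ?_ hl
    have hlq : 0 < l ^ (1 / (1 - α)) := by positivity
    rw [div_le_iff₀ hlq, add_mul, div_mul_cancel₀ _ hlq.ne']
    have := Real.log_le_log (hM0 l hl0) (hK l hl0)
    rwa [Real.log_mul hK0.ne' (Real.exp_pos _).ne', Real.log_exp] at this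

lemma tendsto_log_tail_div [IsFiniteMeasure μ] (hα0 : 0 < α) (hα1 : α < 1) (hB : 0 < B)
    (hM : ∀ l > 0, Integrable (fun x => Real.exp (l * x)) μ)
    (hpos : ∀ x > 0, 0 < μ.real (Ioi x)) (hM0 : ∀ l > 0, 0 < ∫ u, Real.exp (l * u) ∂μ)
    (h : Tendsto (fun l => Real.log (∫ x, Real.exp (l * x) ∂μ) / l ^ (1 / (1 - α))) atTop
      (nhds ((1 - α) * (α / B) ^ (α / (1 - α))))) :
    Tendsto (fun x => Real.log (μ.real (Ioi x)) / x ^ (1 / α)) atTop (nhds (-B)) := by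
  have h1α : 0 < 1 - α := by linarith
  have hs0 : 0 < B / α := by positivity
  have hp1 : 0 < 1 / α - 1 := by linarith [(one_lt_div hα0).2 hα1]
  have hp : 0 < 1 / α := by positivity
  have hr : 0 < α / (1 - α) := by positivity
  have hL : ∀ s > 0, Tendsto (fun x => Real.log (∫ u, Real.exp (s * x ^ (1 / α - 1) * u) ∂μ) /
      x ^ (1 / α)) atTop
      (nhds ((1 - α) * (α / B) ^ (α / (1 - α)) * s ^ (1 / (1 - α)))) := by
    intro s hs
    have hl : Tendsto (fun x : ℝ => s * x ^ (1 / α - 1)) atTop atTop :=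
      (tendsto_rpow_atTop hp1).const_mul_atTop hs
    refine ((h.comp hl).mul_const (s ^ (1 / (1 - α)))).congr' ?_
    filter_upwards [eventually_gt_atTop 0] with x hx
    have h1 : 0 < s ^ (1 / (1 - α)) := by positivity
    have h2 : 0 < x ^ (1 / α) := by positivity
    simp only [Function.comp_apply]
    rw [mul_rpow_rpow_conj hα0 hα1 hs.le hx.le]
    field_simp
  set Λ : ℝ → ℝ := fun s => (1 - α) * (α / B) ^ (α / (1 - α)) * s ^ (1 / (1 - α)) with hΛ
  have hΛ0 : Λ (B / α) = B / α - B := legendre_value hα0 hα1 hB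
  refine tendsto_order.2 ⟨fun a ha => ?_, fun a ha => ?_⟩
  · -- Tilt by a slope slightly larger than the optimal one.
    have hcont : ContinuousAt (fun s : ℝ =>
        Λ s - s * ((α / B * s) ^ (α / (1 - α)) + (s - B / α))) (B / α) := by
      refine (legendre_hasDerivAt hα0 hα1 hB hs0).continuousAt.sub
        (continuousAt_id.mul (ContinuousAt.add ?_ (by fun_prop)))
      exact ContinuousAt.rpow_const (by fun_prop) (Or.inr hr.le)
    have hval : a < Λ (B / α) - B / α * ((α / B * (B / α)) ^ (α / (1 - α)) + (B / α - B / α)) := by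
      have : α / B * (B / α) = 1 := by field_simp
      rw [hΛ0, this, Real.one_rpow]
      linarith
    have hev : ∀ᶠ s in nhdsWithin (B / α) (Ioi (B / α)),
        a < Λ s - s * ((α / B * s) ^ (α / (1 - α)) + (s - B / α)) ∧ B / α < s := by
      filter_upwards [(hcont.eventually_const_lt hval).filter_mono nhdsWithin_le_nhds,
        self_mem_nhdsWithin] with s h1 h2 using ⟨h1, h2⟩
    obtain ⟨s, hsa, hs⟩ := hev.exists
    have hspos : 0 < s := hs0.trans hs
    set y := (α / B * s) ^ (α / (1 - α)) with hy
    have hy1 : 1 < y := by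
      refine Real.one_lt_rpow ?_ hr
      rw [div_lt_iff₀ hα0] at hs
      rw [div_mul_eq_mul_div, one_lt_div hB]
      linarith
    set z := y + (s - B / α) with hz
    have hyz : y < z := by linarith
    have hder : HasDerivAt Λ y s := legendre_hasDerivAt hα0 hα1 hB hspos
    have hA : ∀ᶠ t in nhdsWithin 0 (Ioi (0 : ℝ)), t + Λ (s - t) - Λ s < 0 := by
      have hd : HasDerivAt (fun t : ℝ => t + Λ (s - t)) (1 - y) 0 := by
        have h1 : HasDerivAt Λ y (s - 0) := by rwa [sub_zero]
        have h2 := h1.comp (0 : ℝ) ((hasDerivAt_id (0 : ℝ)).const_sub s)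
        refine ((hasDerivAt_id (0 : ℝ)).add h2).congr_deriv ?_
        ring
      have := (hasDerivAt_iff_tendsto_slope_zero.1 hd).eventually_lt_const
        (show 1 - y < 0 by linarith)
      filter_upwards [this.filter_mono (nhdsWithin_mono 0 fun t (ht : 0 < t) => ht.ne'),
        self_mem_nhdsWithin] with t ht ht0
      have ht0' : 0 < t := ht0
      simp only [zero_add, sub_zero, smul_eq_mul] at ht
      have := neg_of_mul_neg_right ht (inv_nonneg.2 ht0'.le)
      linarith
    have hC : ∀ᶠ t in nhdsWithin 0 (Ioi (0 : ℝ)), -(t * z) + Λ (s + t) - Λ s < 0 := by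
      have := (hasDerivAt_iff_tendsto_slope_zero.1 hder).eventually_lt_const hyz
      filter_upwards [this.filter_mono (nhdsWithin_mono 0 fun t (ht : 0 < t) => ht.ne'),
        self_mem_nhdsWithin] with t ht ht0
      have ht0' : 0 < t := ht0
      rw [smul_eq_mul, inv_mul_lt_iff₀ ht0'] at ht
      linarith
    obtain ⟨t, ⟨⟨htA, htC⟩, (ht0 : 0 < t)⟩, hts⟩ := (((hA.and hC).and self_mem_nhdsWithin).and
      ((eventually_lt_nhds hspos).filter_mono nhdsWithin_le_nhds)).exists
    have hxp : Tendsto (fun x : ℝ => x ^ (1 / α)) atTop atTop := tendsto_rpow_atTop hp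
    set M : ℝ → ℝ := fun l => ∫ u, Real.exp (l * u) ∂μ with hMdef
    have evA : ∀ᶠ x : ℝ in atTop, t * x ^ (1 / α) + Real.log (M ((s - t) * x ^ (1 / α - 1)))
        - Real.log (M (s * x ^ (1 / α - 1))) ≤ -Real.log 4 := by
      refine eventually_le_of_tendsto_div_neg _ htA hxp
        ((((hL (s - t) (by linarith)).const_add t).sub (hL s hspos)).congr' ?_)
      filter_upwards [eventually_gt_atTop 0] with x hx
      have h2 : 0 < x ^ (1 / α) := by positivity
      field_simp
      simp only [hMdef]
    have evC : ∀ᶠ x : ℝ in atTop, -(t * z) * x ^ (1 / α)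
        + Real.log (M ((s + t) * x ^ (1 / α - 1)))
        - Real.log (M (s * x ^ (1 / α - 1))) ≤ -Real.log 4 := by
      refine eventually_le_of_tendsto_div_neg _ htC hxp
        ((((hL (s + t) (by linarith)).const_add (-(t * z))).sub (hL s hspos)).congr' ?_)
      filter_upwards [eventually_gt_atTop 0] with x hx
      have h2 : 0 < x ^ (1 / α) := by positivity
      field_simp
      simp only [hMdef]
    have hlim : Tendsto (fun x : ℝ => Real.log (M (s * x ^ (1 / α - 1))) / x ^ (1 / α) - s * z
        - Real.log 2 / x ^ (1 / α)) atTop (nhds (Λ s - s * z - 0)) :=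
      ((hL s hspos).sub_const _).sub (hxp.const_div_atTop _)
    rw [sub_zero] at hlim
    filter_upwards [evA, evC, hlim.eventually_const_lt hsa, eventually_gt_atTop 0]
      with x hxA hxC hxlim hx
    refine hxlim.trans_le ?_
    have hw : 0 < x ^ (1 / α - 1) := by positivity
    have hww : x ^ (1 / α - 1) * x = x ^ (1 / α) := by
      rw [← Real.rpow_add_one hx.ne', sub_add_cancel]
    have hX : 0 < x ^ (1 / α) := by positivity
    have hτ := hpos x hx
    set w := x ^ (1 / α - 1)
    set X := x ^ (1 / α)
    have m0 : 0 < M (s * w) := hM0 _ (by positivity)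
    have m1 : 0 < M ((s - t) * w) := hM0 _ (mul_pos (by linarith) hw)
    have m2 : 0 < M ((s + t) * w) := hM0 _ (by positivity)
    have key : M (s * w) ≤ Real.exp (t * w * x) * M (s * w - t * w)
        + Real.exp (-(t * w * (z * x))) * M (s * w + t * w)
        + Real.exp (s * w * (z * x)) * μ.real (Ioi x) :=
      integral_exp_le_tilt (by positivity) (by gcongr) hM
    rw [← sub_mul, ← add_mul] at key
    have hexp4 : Real.exp (-Real.log 4) = 1 / 4 := by
      rw [Real.exp_neg, Real.exp_log (by norm_num)]; norm_num
    have b1 : Real.exp (t * w * x) * M ((s - t) * w) ≤ 1 / 4 * M (s * w) := by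
      rw [← hexp4, ← Real.exp_log m1, ← Real.exp_log m0, ← Real.exp_add, ← Real.exp_add,
        mul_assoc t, hww]
      apply Real.exp_le_exp.2
      linarith
    have b2 : Real.exp (-(t * w * (z * x))) * M ((s + t) * w) ≤ 1 / 4 * M (s * w) := by
      have e : -(t * w * (z * x)) = -(t * z) * X := by rw [← hww]; ring
      rw [← hexp4, ← Real.exp_log m2, ← Real.exp_log m0, ← Real.exp_add, ← Real.exp_add, e]
      apply Real.exp_le_exp.2
      linarith
    have b3 : M (s * w) ≤ 2 * (Real.exp (s * w * (z * x)) * μ.real (Ioi x)) := by linarith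
    have b4 := Real.log_le_log m0 b3
    have e : s * w * (z * x) = s * z * X := by rw [← hww]; ring
    rw [Real.log_mul (by norm_num) (by positivity), Real.log_mul (by positivity) hτ.ne',
      Real.log_exp, e] at b4
    rw [le_div_iff₀ hX, sub_mul, sub_mul, div_mul_cancel₀ _ hX.ne', div_mul_cancel₀ _ hX.ne']
    linarith
  · have hlim := (hL _ hs0).sub_const (B / α)
    change Tendsto _ _ (nhds (Λ (B / α) - B / α)) at hlim
    rw [hΛ0, show B / α - B - B / α = -B by ring] at hlim
    filter_upwards [hlim.eventually_lt_const ha, eventually_gt_atTop 0] with x hx hx0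
    have := add_log_tail_div_le (α := α) hs0 hx0 hM (hpos x hx0)
    linarith

end

end Kasahara

/-- Kasahara's Tauberian theorem. -/
theorem kasahara (μ : Measure ℝ) (α B : ℝ) (hα0 : 0 < α) (hα1 : α < 1) (hB : 0 < B)
    (hsupp : μ (Iic 0) = 0)
    (hM : ∀ l > 0, Integrable (fun x => Real.exp (l * x)) μ)
    (hpos : ∀ x > 0, 0 < μ (Ioi x)) :
    (Tendsto (fun x => Real.log (μ (Ioi x)).toReal / (-B * x ^ (1 / α))) atTop (nhds 1) ↔
     Tendsto (fun l => Real.log (∫ x, Real.exp (l * x) ∂μ) /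
       ((1 - α) * (α / B) ^ (α / (1 - α)) * l ^ (1 / (1 - α)))) atTop (nhds 1)) := by
  have h1α : 0 < 1 - α := by linarith
  have hfin := Kasahara.isFiniteMeasure_of_integrable_exp one_pos hsupp (hM 1 one_pos)
  have hpos' : ∀ x > 0, 0 < μ.real (Ioi x) := fun x hx =>
    ENNReal.toReal_pos (hpos x hx).ne' (measure_ne_top _ _)
  have hM0 : ∀ l > 0, 0 < ∫ u, Real.exp (l * u) ∂μ := fun l hl =>
    (mul_pos (Real.exp_pos _) (hpos' 1 one_pos)).trans_le (Kasahara.exp_mul_tail_le hl (hM l hl))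
  have hC : (1 - α) * (α / B) ^ (α / (1 - α)) ≠ 0 := by positivity
  rw [Kasahara.tendsto_div_const_mul_iff (neg_ne_zero.2 hB.ne'),
    Kasahara.tendsto_div_const_mul_iff hC]
  exact ⟨Kasahara.tendsto_log_moment_div hα0 hα1 hB hM hpos' hM0,
    Kasahara.tendsto_log_tail_div hα0 hα1 hB hM hpos' hM0⟩
end

section
/- (Proposition CK, Cadena–Kratz.) U belongs to the class M with M-index ρ_U = τ if and only if log(U(x)) / log(x) → τ as x → ∞. -/
open Real Filter MeasureTheory Set

lemma log_div_log_lt_iff_lt_rpow {x y a : ℝ} (hx : 1 < x) (hy : 0 < y) :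
    Real.log y / Real.log x < a ↔ y < x ^ a := by
  rw [div_lt_iff₀ (Real.log_pos hx), Real.lt_rpow_iff_log_lt hy (by linarith)]

lemma lt_log_div_log_iff_rpow_lt {x y a : ℝ} (hx : 1 < x) (hy : 0 < y) :
    a < Real.log y / Real.log x ↔ x ^ a < y := by
  rw [lt_div_iff₀ (Real.log_pos hx), Real.rpow_lt_iff_lt_log (by linarith) hy]

/-- Proposition CK (Cadena–Kratz): U is in the class M with M-index τ iff
log U(x) / log x → τ as x → ∞. -/
theorem cadena_kratz (U : ℝ → ℝ) (τ : ℝ) (hUmeas : Measurable U)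
    (hUpos : ∀ x > 0, 0 < U x) :
    ((∀ ε > 0, Tendsto (fun x => U x / x ^ (τ + ε)) atTop (nhds 0) ∧
        Tendsto (fun x => U x / x ^ (τ - ε)) atTop atTop) ↔
     Tendsto (fun x => Real.log (U x) / Real.log x) atTop (nhds τ)) := by
  constructor
  · intro h
    refine tendsto_order.2 ⟨fun a ha => ?_, fun a ha => ?_⟩
    · have hlim := (h (τ - a) (sub_pos.2 ha)).2
      filter_upwards [hlim.eventually_gt_atTop 1, eventually_gt_atTop 1] with x hUx hx
      have hx0 : 0 < x := by linarith
      rw [sub_sub_cancel, one_lt_div (Real.rpow_pos_of_pos hx0 _)] at hUx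
      exact (lt_log_div_log_iff_rpow_lt hx (hUpos x hx0)).2 hUx
    · have hlim := (h (a - τ) (sub_pos.2 ha)).1
      filter_upwards [hlim.eventually_lt_const one_pos, eventually_gt_atTop 1] with x hUx hx
      have hx0 : 0 < x := by linarith
      rw [add_sub_cancel, div_lt_one (Real.rpow_pos_of_pos hx0 _)] at hUx
      exact (log_div_log_lt_iff_lt_rpow hx (hUpos x hx0)).2 hUx
  · intro h ε hε
    constructor
    · have hbound : ∀ᶠ x in atTop, U x / x ^ (τ + ε) ≤ x ^ (-(ε / 2)) := by
        filter_upwards [h.eventually_lt_const (show τ < τ + ε / 2 by linarith),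
          eventually_gt_atTop 1] with x hUx hx
        have hx0 : 0 < x := by linarith
        rw [log_div_log_lt_iff_lt_rpow hx (hUpos x hx0)] at hUx
        rw [div_le_iff₀ (Real.rpow_pos_of_pos hx0 _), ← Real.rpow_add hx0]
        convert hUx.le using 2
        ring
      refine squeeze_zero' ?_ hbound (tendsto_rpow_neg_atTop (half_pos hε))
      filter_upwards [eventually_gt_atTop 0] with x hx
      exact (div_pos (hUpos x hx) (Real.rpow_pos_of_pos hx _)).le
    · refine tendsto_atTop_mono' _ ?_ (tendsto_rpow_atTop (half_pos hε))
      filter_upwards [h.eventually_const_lt (show τ - ε / 2 < τ by linarith),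
        eventually_gt_atTop 1] with x hUx hx
      have hx0 : 0 < x := by linarith
      rw [lt_log_div_log_iff_rpow_lt hx (hUpos x hx0)] at hUx
      rw [le_div_iff₀ (Real.rpow_pos_of_pos hx0 _), ← Real.rpow_add hx0]
      convert hUx.le using 2
      ring
end
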